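/- arXiv:math/0606690 — 3 statements merged into one kernel-verified Lean document; each statement's English description precedes it below -/
import Mathlib

section
/- There exists a triangulation of the nonorientable surface N_3 which has no noncontractible separating cycle separating the surface into the projective plane N_1 and the Klein bottle N_2 (i.e., no NSC whose two capped pieces are homeomorphic to N_1 and N_2, respectively). -/
open scoped Classical

/-- A combinatorial triangulation of a closed surface: a finite set of triangular
faces (3-element subsets of `ℕ`) such that every edge lies in exactly two faces,
the faces around each vertex form a single cycle (the link condition), and the
whole complex is connected.  The underlying simple graph has as edges the
2-element subsets of faces. -/
structure Triangulation where
  faces : Finset (Finset ℕ)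
  faces_nonempty : faces.Nonempty
  card_eq_three : ∀ f ∈ faces, f.card = 3
  edge_in_two_faces : ∀ e : Finset ℕ, e.card = 2 → (∃ f ∈ faces, e ⊆ f) →
    (faces.filter (fun f => e ⊆ f)).card = 2
  link_connected : ∀ v : ℕ, ∀ f ∈ faces, ∀ g ∈ faces, v ∈ f → v ∈ g →
    Relation.ReflTransGen
      (fun f' g' => f' ∈ faces ∧ g' ∈ faces ∧ v ∈ f' ∧ v ∈ g' ∧ (f' ∩ g').card = 2) f g
  face_connected : ∀ f ∈ faces, ∀ g ∈ faces,
    Relation.ReflTransGen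
      (fun f' g' => f' ∈ faces ∧ g' ∈ faces ∧ (f' ∩ g').card = 2) f g

namespace Triangulation

/-- The vertices spanned by a set of faces. -/
def vertsOf (F : Finset (Finset ℕ)) : Finset ℕ := F.sup id

/-- The edges spanned by a set of triangular faces: all 2-element subsets of faces. -/
def edgesOf (F : Finset (Finset ℕ)) : Finset (Finset ℕ) :=
  (Finset.powersetCard 2 (vertsOf F)).filter (fun e => ∃ f ∈ F, e ⊆ f)

/-- The vertex set of a triangulation. -/
def verts (T : Triangulation) : Finset ℕ := vertsOf T.faces

/-- The edge set of a triangulation. -/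
def edges (T : Triangulation) : Finset (Finset ℕ) := edgesOf T.faces

/-- The Euler characteristic `V - E + F` of a triangulation. -/
def euler (T : Triangulation) : ℤ :=
  (T.verts.card : ℤ) - (T.edges.card : ℤ) + (T.faces.card : ℤ)

/-- The three directed edges of an ordered triple (an oriented triangle). -/
def dedges (t : ℕ × ℕ × ℕ) : Finset (ℕ × ℕ) :=
  {(t.1, t.2.1), (t.2.1, t.2.2), (t.2.2, t.1)}

/-- `σ` is a coherent orientation of the set `F` of triangular faces: it assigns to each
face an oriented triangle with that vertex set, so that no directed edge is used twice
(equivalently, the two faces sharing an edge traverse that edge in opposite directions). -/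
def IsCoherent (F : Finset (Finset ℕ)) (σ : Finset ℕ → ℕ × ℕ × ℕ) : Prop :=
  (∀ f ∈ F, ({(σ f).1, (σ f).2.1, (σ f).2.2} : Finset ℕ) = f) ∧
  (∀ f ∈ F, ∀ g ∈ F, f ≠ g → Disjoint (dedges (σ f)) (dedges (σ g)))

/-- A triangulation is orientable if its faces admit a coherent orientation. -/
def Orientable (T : Triangulation) : Prop := ∃ σ, IsCoherent T.faces σ

/-- `T` is a triangulation of the orientable surface `S_g` of genus `g`
(Euler characteristic `2 - 2g`). -/
def IsS (g : ℕ) (T : Triangulation) : Prop :=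
  T.euler = 2 - 2 * (g : ℤ) ∧ T.Orientable

/-- `T` is a triangulation of the nonorientable surface `N_g` of genus `g`
(Euler characteristic `2 - g`). -/
def IsN (g : ℕ) (T : Triangulation) : Prop :=
  T.euler = 2 - (g : ℤ) ∧ ¬ T.Orientable

/-- The edges of the cyclic vertex sequence `c`. -/
def cycEdges (c : List ℕ) : Finset (Finset ℕ) :=
  (Finset.range c.length).image
    (fun i => ({c.getD i 0, c.getD ((i + 1) % c.length) 0} : Finset ℕ))

/-- `c` is a cycle of the triangulation `T`: at least three distinct vertices,
consecutive ones (cyclically) joined by edges of `T`. -/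
def IsCycle (T : Triangulation) (c : List ℕ) : Prop :=
  3 ≤ c.length ∧ c.Nodup ∧ ∀ e ∈ cycEdges c, e ∈ T.edges

/-- Faces `f` and `g` lie in the same component of `S - C`, where `C` is the closed curve
corresponding to the cycle `c`: they are joined by a chain of faces consecutively sharing
edges that are not edges of the cycle. -/
def SameSide (T : Triangulation) (c : List ℕ) (f g : Finset ℕ) : Prop :=
  Relation.ReflTransGen
    (fun f' g' => f' ∈ T.faces ∧ g' ∈ T.faces ∧ (f' ∩ g').card = 2 ∧
      f' ∩ g' ∉ cycEdges c) f g

/-- The cycle `c` separates the surface: `S - C` is disconnected. -/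
def Separating (T : Triangulation) (c : List ℕ) : Prop :=
  ∃ f ∈ T.faces, ∃ g ∈ T.faces, ¬ SameSide T c f g

/-- The faces in the component of `S - C` containing the face `f`. -/
noncomputable def sideFaces (T : Triangulation) (c : List ℕ) (f : Finset ℕ) :
    Finset (Finset ℕ) :=
  T.faces.filter (fun g => SameSide T c f g)

/-- The Euler characteristic of the component of `f` in the surface cut along the cycle
`c`, capped with a single new face (`+1`). -/
noncomputable def sideEuler (T : Triangulation) (c : List ℕ) (f : Finset ℕ) : ℤ :=
  ((vertsOf (sideFaces T c f)).card : ℤ) - ((edgesOf (sideFaces T c f)).card : ℤ)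
    + ((sideFaces T c f).card : ℤ) + 1

/-- The Euler genus `2 - χ` of the capped component of `f` in the surface cut
along the cycle `c`. -/
noncomputable def sideEulerGenus (T : Triangulation) (c : List ℕ) (f : Finset ℕ) : ℤ :=
  2 - sideEuler T c f

/-- The capped component of `f` in the surface cut along the cycle `c` is orientable. -/
def SideOrientable (T : Triangulation) (c : List ℕ) (f : Finset ℕ) : Prop :=
  ∃ σ, IsCoherent (sideFaces T c f) σ

/-- `c` is a noncontractible separating cycle (NSC): it separates the surface and
neither capped component is a triangulation of the sphere (`χ = 2`). -/
def IsNSC (T : Triangulation) (c : List ℕ) : Prop :=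
  IsCycle T c ∧ Separating T c ∧ ∀ f ∈ T.faces, sideEuler T c f ≠ 2

/-- A coherent orientation of the faces of `T` in which the gluing across the edges of the
cycle `c` is ignored: this orients the surface obtained by cutting along `c`. -/
def IsCutCoherent (T : Triangulation) (c : List ℕ) (σ : Finset ℕ → ℕ × ℕ × ℕ) : Prop :=
  (∀ f ∈ T.faces, ({(σ f).1, (σ f).2.1, (σ f).2.2} : Finset ℕ) = f) ∧
  (∀ f ∈ T.faces, ∀ g ∈ T.faces, f ≠ g → f ∩ g ∉ cycEdges c →
    Disjoint (dedges (σ f)) (dedges (σ g)))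

/-- The cycle `c` is orientable-leaving: the surface obtained by cutting along `c`
is orientable. -/
def OrientableLeaving (T : Triangulation) (c : List ℕ) : Prop :=
  ∃ σ, IsCutCoherent T c σ

/-- A corner of the cycle `c`: a pair `(i, f)` where `f` is a face containing the `i`-th
vertex of `c`. -/
def IsCorner (T : Triangulation) (c : List ℕ) (x : ℕ × Finset ℕ) : Prop :=
  x.1 < c.length ∧ x.2 ∈ T.faces ∧ c.getD x.1 0 ∈ x.2

/-- Two corners lie on a common boundary segment of the surface cut along `c`:
either they are corners at the same cycle vertex whose faces share an edge through that
vertex not lying on the cycle, or they are corners of one face containing a cycle edge,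
at the two endpoints of that edge. -/
def CornerRel (T : Triangulation) (c : List ℕ) (x y : ℕ × Finset ℕ) : Prop :=
  IsCorner T c x ∧ IsCorner T c y ∧
  ((x.1 = y.1 ∧ (x.2 ∩ y.2).card = 2 ∧ c.getD x.1 0 ∈ x.2 ∩ y.2 ∧
      x.2 ∩ y.2 ∉ cycEdges c) ∨
    (y.1 = (x.1 + 1) % c.length ∧ x.2 = y.2 ∧
      ({c.getD x.1 0, c.getD y.1 0} : Finset ℕ) ⊆ x.2))

/-- The cycle `c` is one-sided: cutting the surface along `c` produces a single boundary
cycle, i.e. all corners along `c` lie on one boundary component (the neighborhood of the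
curve is a Möbius band).  A nonseparating cycle is two-sided iff it is not one-sided. -/
def OneSided (T : Triangulation) (c : List ℕ) : Prop :=
  ∀ x y, IsCorner T c x → IsCorner T c y → Relation.EqvGen (CornerRel T c) x y

/-- The 3-cycles (triangles) of the graph of `T`. -/
def triangles (T : Triangulation) : Finset (Finset ℕ) :=
  (Finset.powersetCard 3 T.verts).filter
    (fun t => ∀ e ∈ Finset.powersetCard 2 t, e ∈ T.edges)

/-- An edge of `T` is contractible iff it lies in exactly two 3-cycles of the graph of
`T` (for any triangulation other than `K₄` on the sphere, this is equivalent to the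
contraction of the edge yielding again a triangulation of the same surface). -/
def ContractibleEdge (T : Triangulation) (e : Finset ℕ) : Prop :=
  e ∈ T.edges ∧ (T.triangles.filter (fun t => e ⊆ t)).card = 2

/-- A triangulation is irreducible if it has no contractible edge. -/
def Irreducible (T : Triangulation) : Prop :=
  ∀ e, ¬ ContractibleEdge T e

/-- Two face sets are equivalent if some relabelling of the vertices carries one onto the
other (such a bijection carries faces to faces and hence edges to edges). -/
def FacesEquiv (F F' : Finset (Finset ℕ)) : Prop :=
  ∃ φ : ℕ ≃ ℕ, F' = F.image (fun f => f.image φ)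

/-- Two triangulations are equivalent if some vertex bijection carries faces to faces
(and hence edges to edges). -/
def EquivTri (T T' : Triangulation) : Prop := FacesEquiv T.faces T'.faces

/-- `T'` is obtained from `T` by a diagonal flip: the edge `{a,c}`, lying in the faces
`{a,b,c}` and `{a,c,d}` with `{b,d}` not an edge, is replaced by `{b,d}` and the two
faces by `{a,b,d}` and `{b,c,d}`. -/
def Flip (T T' : Triangulation) : Prop :=
  ∃ a b c d : ℕ, ({a, b, c} : Finset ℕ) ∈ T.faces ∧ ({a, c, d} : Finset ℕ) ∈ T.faces ∧
    b ≠ d ∧ ({b, d} : Finset ℕ) ∉ T.edges ∧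
    T'.faces = (T.faces \ {({a, b, c} : Finset ℕ), ({a, c, d} : Finset ℕ)}) ∪
      {({a, b, d} : Finset ℕ), ({b, c, d} : Finset ℕ)}

/-- Two triangulations are equivalent under diagonal flips if a finite sequence of
diagonal flips transforms one into a triangulation equivalent to the other. -/
def FlipEquiv (T T' : Triangulation) : Prop :=
  ∃ T'' : Triangulation, Relation.ReflTransGen Flip T T'' ∧ EquivTri T'' T'

end Triangulation

namespace Triangulation

/-- The vertex set of an ordered triple. -/
def toFace (t : ℕ × ℕ × ℕ) : Finset ℕ := {t.1, t.2.1, t.2.2}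

/-- The ordered triple traversed in the opposite direction. -/
def rev (t : ℕ × ℕ × ℕ) : ℕ × ℕ × ℕ := (t.1, t.2.2, t.2.1)

/-- The nine oriented triangles obtained from the six-vertex projective plane by removing the
face `{0, 1, 2}`, followed by the thirteen obtained from the seven-vertex torus by removing
the same face. -/
def orientedFaces : List (ℕ × ℕ × ℕ) :=
  [(0, 2, 3), (0, 4, 3), (0, 5, 4), (0, 5, 1), (1, 4, 2), (2, 5, 3), (1, 3, 4), (2, 4, 5),
    (1, 5, 3),
    (1, 7, 6), (2, 6, 8), (2, 9, 7), (0, 8, 7), (1, 9, 8), (0, 9, 6), (0, 6, 2), (1, 2, 7),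
    (6, 7, 8), (2, 8, 9), (0, 7, 9), (0, 1, 8), (1, 6, 9)]

/-- The faces of the connected sum of the six-vertex projective plane and the seven-vertex
torus along the triangle `{0, 1, 2}`. -/
def sumFaces : Finset (Finset ℕ) := (orientedFaces.map toFace).toFinset

/-- Enlarge a set `S` of faces by all members of `F` sharing an edge with a member of `S`. -/
def grow (F S : Finset (Finset ℕ)) : Finset (Finset ℕ) :=
  S ∪ F.filter (fun g => ∃ f ∈ S, (f ∩ g).card = 2)

lemma reflTransGen_of_mem_iterate_grow {F : Finset (Finset ℕ)} {f : Finset ℕ} (hf : f ∈ F)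
    (n : ℕ) : ∀ g ∈ (grow F)^[n] {f}, g ∈ F ∧
      Relation.ReflTransGen (fun f' g' => f' ∈ F ∧ g' ∈ F ∧ (f' ∩ g').card = 2) f g := by
  induction n with
  | zero =>
    intro g hg
    obtain rfl : g = f := by simpa using hg
    exact ⟨hf, .refl⟩
  | succ n ih =>
    intro g hg
    rw [Function.iterate_succ_apply', grow, Finset.mem_union, Finset.mem_filter] at hg
    obtain hg | ⟨hg, h, hh, hc⟩ := hg
    · exact ih g hg
    · exact ⟨hg, (ih h hh).2.tail ⟨(ih h hh).1, hg, hc⟩⟩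

lemma sumFaces_subset_iterate_grow :
    ∀ f ∈ sumFaces, ∀ g ∈ sumFaces, g ∈ (grow sumFaces)^[8] {f} := by
  decide +kernel

lemma sumFaces_link_subset_iterate_grow :
    ∀ f ∈ sumFaces, ∀ v ∈ f, ∀ g ∈ sumFaces, v ∈ g →
      g ∈ (grow (sumFaces.filter (v ∈ ·)))^[5] {f} := by
  decide +kernel

lemma card_filter_sumFaces :
    ∀ f ∈ sumFaces, ∀ e ∈ f.powersetCard 2, (sumFaces.filter (fun f => e ⊆ f)).card = 2 := by
  decide +kernel

/-- The connected sum of the six-vertex projective plane and the seven-vertex torus. -/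
def projectivePlaneSumTorus : Triangulation where
  faces := sumFaces
  faces_nonempty := by decide +kernel
  card_eq_three := by decide +kernel
  edge_in_two_faces := by
    rintro e he ⟨f, hf, hef⟩
    exact card_filter_sumFaces f hf e (Finset.mem_powersetCard.2 ⟨hef, he⟩)
  link_connected := by
    intro v f hf g hg hvf hvg
    have h := (reflTransGen_of_mem_iterate_grow (Finset.mem_filter.2 ⟨hf, hvf⟩) 5 g
      (sumFaces_link_subset_iterate_grow f hf v hvf g hg hvg)).2
    refine Relation.ReflTransGen.mono ?_ _ _ h
    rintro a b ⟨ha, hb, hab⟩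
    rw [Finset.mem_filter] at ha hb
    exact ⟨ha.1, hb.1, ha.2, hb.2, hab⟩
  face_connected := fun f hf g hg =>
    (reflTransGen_of_mem_iterate_grow hf 8 g (sumFaces_subset_iterate_grow f hf g hg)).2

lemma euler_projectivePlaneSumTorus : projectivePlaneSumTorus.euler = -1 := by
  have hv : (vertsOf sumFaces).card = 10 := by decide +kernel
  have he : (edgesOf sumFaces).card = 33 := by decide +kernel
  have hf : sumFaces.card = 22 := by decide +kernel
  change ((vertsOf sumFaces).card : ℤ) - (edgesOf sumFaces).card + sumFaces.card = -1
  rw [hv, he, hf]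
  norm_num

lemma dedges_eq_or_eq_rev : ∀ t ∈ orientedFaces, ∀ p ∈ toFace t ×ˢ toFace t ×ˢ toFace t,
    toFace p = toFace t → dedges p = dedges t ∨ dedges p = dedges (rev t) := by
  decide +kernel

/-- Along a cyclic sequence of five triangles forming a Möbius band, no choice of
orientations is coherent. -/
lemma not_orientable_projectivePlaneSumTorus : ¬ projectivePlaneSumTorus.Orientable := by
  rintro ⟨σ, hσ, hd⟩
  have key : ∀ t ∈ orientedFaces,
      dedges (σ (toFace t)) = dedges t ∨ dedges (σ (toFace t)) = dedges (rev t) := by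
    intro t ht
    have h : toFace (σ (toFace t)) = toFace t :=
      hσ _ (List.mem_toFinset.2 (List.mem_map_of_mem ht))
    refine dedges_eq_or_eq_rev t ht _ ?_ h
    simp only [Finset.mem_product]
    refine ⟨?_, ?_, ?_⟩ <;> apply h.subset <;> simp [toFace]
  have h₁ := key (1, 4, 2) (by decide)
  have h₂ := key (1, 3, 4) (by decide)
  have h₃ := key (1, 5, 3) (by decide)
  have h₄ := key (2, 5, 3) (by decide)
  have h₅ := key (2, 4, 5) (by decide)
  have d₁ := hd (toFace (1, 4, 2)) (by decide +kernel) (toFace (1, 3, 4)) (by decide +kernel)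
    (by decide +kernel)
  have d₂ := hd (toFace (1, 3, 4)) (by decide +kernel) (toFace (1, 5, 3)) (by decide +kernel)
    (by decide +kernel)
  have d₃ := hd (toFace (1, 5, 3)) (by decide +kernel) (toFace (2, 5, 3)) (by decide +kernel)
    (by decide +kernel)
  have d₄ := hd (toFace (2, 5, 3)) (by decide +kernel) (toFace (2, 4, 5)) (by decide +kernel)
    (by decide +kernel)
  have d₅ := hd (toFace (2, 4, 5)) (by decide +kernel) (toFace (1, 4, 2)) (by decide +kernel)
    (by decide +kernel)
  rcases h₁ with h₁ | h₁ <;> rcases h₂ with h₂ | h₂ <;> rcases h₃ with h₃ | h₃ <;>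
    rcases h₄ with h₄ | h₄ <;> rcases h₅ with h₅ | h₅ <;>
    rw [h₁, h₂] at d₁ <;> rw [h₂, h₃] at d₂ <;> rw [h₃, h₄] at d₃ <;> rw [h₄, h₅] at d₄ <;>
    rw [h₅, h₁] at d₅ <;> revert d₁ d₂ d₃ d₄ d₅ <;> decide +kernel

/-- At most two edges of a cycle contain a given vertex. -/
lemma card_filter_mem_cycEdges_le_two {c : List ℕ} (hc : c.Nodup) (v : ℕ) :
    ((cycEdges c).filter (v ∈ ·)).card ≤ 2 := by
  set e : ℕ → Finset ℕ := fun i => {c.getD i 0, c.getD ((i + 1) % c.length) 0} with he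
  set k := c.idxOf v with hk
  refine (Finset.card_le_card (t := {e k, e ((k + (c.length - 1)) % c.length)}) ?_).trans
    Finset.card_le_two
  have index_eq : ∀ i < c.length, v = c.getD i 0 → i = k := by
    intro i hi h
    rw [hk, h, List.getD_eq_getElem _ _ hi, hc.idxOf_getElem]
  intro x hx
  simp only [cycEdges, Finset.mem_filter, Finset.mem_image, Finset.mem_range] at hx
  obtain ⟨⟨i, hi, rfl⟩, hv⟩ := hx
  rw [Finset.mem_insert, Finset.mem_singleton] at hv ⊢
  obtain hv | hv := hv
  · left
    rw [← index_eq i hi hv]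
  · right
    have h := index_eq _ (Nat.mod_lt _ (by lia)) hv
    have : (k + (c.length - 1)) % c.length = i := by
      rw [← h, Nat.mod_add_mod, show i + 1 + (c.length - 1) = i + c.length by lia,
        Nat.add_mod_right, Nat.mod_eq_of_lt hi]
    rw [this]

lemma SameSide.symm {T : Triangulation} {c : List ℕ} {f g : Finset ℕ} (h : T.SameSide c f g) :
    T.SameSide c g f := by
  refine (@Relation.ReflTransGen.stdSymm _ _ ⟨?_⟩).symm _ _ h
  rintro a b ⟨ha, hb, hab, hc⟩
  rw [Finset.inter_comm] at hab hc
  exact ⟨hb, ha, hab, hc⟩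

/-- Among pairs of faces sharing distinct edges at a vertex `v`, at most two are separated by
a side of a cycle. -/
lemma countP_sideFaces_ne_le_two {T : Triangulation} {c : List ℕ} (hc : c.Nodup)
    (f : Finset ℕ) (v : ℕ) (l : List (Finset ℕ × Finset ℕ))
    (hl : ∀ p ∈ l, p.1 ∈ T.faces ∧ p.2 ∈ T.faces ∧ (p.1 ∩ p.2).card = 2 ∧ v ∈ p.1 ∩ p.2)
    (hnd : (l.map fun p => p.1 ∩ p.2).Nodup) :
    (l.map fun p => (decide (p.1 ∈ T.sideFaces c f), decide (p.2 ∈ T.sideFaces c f))).countP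
      (fun q => q.1 != q.2) ≤ 2 := by
  rw [List.countP_map, List.countP_eq_length_filter]
  set l' := l.filter _ with hl'
  have hnd' : (l'.map fun p => p.1 ∩ p.2).Nodup := hnd.sublist (List.filter_sublist.map _)
  rw [← List.length_map (fun p : Finset ℕ × Finset ℕ => p.1 ∩ p.2),
    ← List.toFinset_card_of_nodup hnd']
  refine (Finset.card_le_card ?_).trans (card_filter_mem_cycEdges_le_two hc v)
  intro e he
  obtain ⟨p, hp, rfl⟩ := List.mem_map.1 (List.mem_toFinset.1 he)
  obtain ⟨hpl, hne⟩ := List.mem_filter.1 hp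
  obtain ⟨h₁, h₂, hcard, hv⟩ := hl p hpl
  refine Finset.mem_filter.2 ⟨?_, hv⟩
  by_contra hcyc
  have h₁₂ : T.SameSide c p.1 p.2 := .single ⟨h₁, h₂, hcard, hcyc⟩
  have hiff : p.1 ∈ T.sideFaces c f ↔ p.2 ∈ T.sideFaces c f := by
    simp only [sideFaces, Finset.mem_filter, h₁, h₂, true_and]
    exact ⟨fun h => h.trans h₁₂, fun h => h.trans h₁₂.symm⟩
  simp [hiff] at hne

/-- The orientation of the faces given by `orientedFaces`, reversed on the faces in `R`. -/
def switched (R : List (Finset ℕ)) (f : Finset ℕ) : ℕ × ℕ × ℕ :=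
  let t := (orientedFaces.find? fun t => toFace t = f).getD (0, 0, 0)
  if f ∈ R then rev t else t

lemma toFace_switched (R : List (Finset ℕ)) : ∀ f ∈ sumFaces, toFace (switched R f) = f := by
  have h : ∀ f ∈ sumFaces,
      toFace ((orientedFaces.find? fun t => toFace t = f).getD (0, 0, 0)) = f ∧
      toFace (rev ((orientedFaces.find? fun t => toFace t = f).getD (0, 0, 0))) = f := by
    decide +kernel
  intro f hf
  rw [switched]
  split_ifs
  exacts [(h f hf).2, (h f hf).1]

lemma exists_isCoherent_of_avoids (R : List (Finset ℕ)) (P : List (Finset ℕ × Finset ℕ))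
    (hP : ∀ f ∈ sumFaces, ∀ g ∈ sumFaces, f ≠ g → (f, g) ∈ P ∨ (g, f) ∈ P ∨
      Disjoint (dedges (switched R f)) (dedges (switched R g)))
    {F : Finset (Finset ℕ)} (hF : F ⊆ sumFaces) (hav : ∀ p ∈ P, ¬ (p.1 ∈ F ∧ p.2 ∈ F)) :
    ∃ σ, IsCoherent F σ := by
  refine ⟨switched R, fun f hf => toFace_switched R f (hF hf), fun f hf g hg hfg => ?_⟩
  obtain h | h | h := hP f (hF hf) g (hF hg) hfg
  · exact absurd ⟨hf, hg⟩ (hav _ h)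
  · exact absurd ⟨hg, hf⟩ (hav _ h)
  · exact h

/-- The pairs of faces meeting along the one-sided triangle `0 3 5`. -/
def pairs035 : List (Finset ℕ × Finset ℕ) :=
  [({0, 2, 3}, {0, 3, 4}), ({0, 4, 5}, {0, 1, 5}), ({2, 3, 5}, {1, 3, 5})]

/-- The pairs of faces meeting along the one-sided triangle `1 4 5`. -/
def pairs145 : List (Finset ℕ × Finset ℕ) :=
  [({1, 2, 4}, {1, 3, 4}), ({0, 1, 5}, {1, 3, 5}), ({0, 4, 5}, {2, 4, 5})]

/-- The pairs of faces meeting along the one-sided triangle `2 3 4`. -/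
def pairs234 : List (Finset ℕ × Finset ℕ) :=
  [({0, 2, 3}, {2, 3, 5}), ({1, 2, 4}, {2, 4, 5}), ({0, 3, 4}, {1, 3, 4})]

lemma exists_isCoherent_of_avoids_triangle {F : Finset (Finset ℕ)} (hF : F ⊆ sumFaces)
    (h : (∀ p ∈ pairs035, ¬ (p.1 ∈ F ∧ p.2 ∈ F)) ∨ (∀ p ∈ pairs145, ¬ (p.1 ∈ F ∧ p.2 ∈ F)) ∨
      ∀ p ∈ pairs234, ¬ (p.1 ∈ F ∧ p.2 ∈ F)) : ∃ σ, IsCoherent F σ := by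
  obtain h | h | h := h
  · exact exists_isCoherent_of_avoids [] _ (by decide +kernel) hF h
  · exact exists_isCoherent_of_avoids [{0, 3, 4}, {0, 4, 5}, {1, 3, 4}, {1, 3, 5}] _
      (by decide +kernel) hF h
  · exact exists_isCoherent_of_avoids [{0, 3, 4}, {0, 4, 5}, {2, 3, 5}, {2, 4, 5}] _
      (by decide +kernel) hF h

set_option synthInstance.maxSize 256 in
/-- If a two-colouring of the nine faces of the Möbius band changes colour across at most two
interior edges at each vertex, then one of the colours contains no pair of faces adjacent
along one of the three one-sided triangles. -/
lemma colouring_avoids (f023 f034 f045 f015 f124 f235 f134 f245 f135 : Bool)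
    (h₀ : [(f023, f034), (f034, f045), (f045, f015)].countP (fun q => q.1 != q.2) ≤ 2)
    (h₁ : [(f015, f135), (f135, f134), (f134, f124)].countP (fun q => q.1 != q.2) ≤ 2)
    (h₂ : [(f023, f235), (f235, f245), (f245, f124)].countP (fun q => q.1 != q.2) ≤ 2)
    (h₃ : [(f023, f034), (f034, f134), (f134, f135), (f135, f235), (f235, f023)].countP
      (fun q => q.1 != q.2) ≤ 2)
    (h₄ : [(f034, f045), (f045, f245), (f245, f124), (f124, f134), (f134, f034)].countP
      (fun q => q.1 != q.2) ≤ 2)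
    (h₅ : [(f045, f015), (f015, f135), (f135, f235), (f235, f245), (f245, f045)].countP
      (fun q => q.1 != q.2) ≤ 2) :
    ∃ b : Bool,
      (∀ q ∈ [(f023, f034), (f045, f015), (f235, f135)], ¬ (q.1 = b ∧ q.2 = b)) ∨
      (∀ q ∈ [(f124, f134), (f015, f135), (f045, f245)], ¬ (q.1 = b ∧ q.2 = b)) ∨
      ∀ q ∈ [(f023, f235), (f124, f245), (f034, f134)], ¬ (q.1 = b ∧ q.2 = b) := by
  revert f023 f034 f045 f015 f124 f235 f134 f245 f135
  decide +kernel

/-- Of two different sides of a cycle, at least one is orientable. -/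
lemma sideOrientable_or_sideOrientable {c : List ℕ} (hc : c.Nodup) {f g : Finset ℕ}
    (hfg : ¬ projectivePlaneSumTorus.SameSide c f g) :
    projectivePlaneSumTorus.SideOrientable c f ∨
      projectivePlaneSumTorus.SideOrientable c g := by
  have hA : projectivePlaneSumTorus.sideFaces c f ⊆ sumFaces := Finset.filter_subset _ _
  have hB : projectivePlaneSumTorus.sideFaces c g ⊆ sumFaces := Finset.filter_subset _ _
  have hdisj : ∀ x ∈ projectivePlaneSumTorus.sideFaces c g,
      decide (x ∈ projectivePlaneSumTorus.sideFaces c f) = false := by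
    intro x hx
    rw [decide_eq_false_iff_not]
    intro hx'
    exact hfg ((Finset.mem_filter.1 hx').2.trans (Finset.mem_filter.1 hx).2.symm)
  have count := countP_sideFaces_ne_le_two (T := projectivePlaneSumTorus) hc f
  have h₀ := count 0 [({0, 2, 3}, {0, 3, 4}), ({0, 3, 4}, {0, 4, 5}), ({0, 4, 5}, {0, 1, 5})]
    (by decide +kernel) (by decide +kernel)
  have h₁ := count 1 [({0, 1, 5}, {1, 3, 5}), ({1, 3, 5}, {1, 3, 4}), ({1, 3, 4}, {1, 2, 4})]
    (by decide +kernel) (by decide +kernel)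
  have h₂ := count 2 [({0, 2, 3}, {2, 3, 5}), ({2, 3, 5}, {2, 4, 5}), ({2, 4, 5}, {1, 2, 4})]
    (by decide +kernel) (by decide +kernel)
  have h₃ := count 3 [({0, 2, 3}, {0, 3, 4}), ({0, 3, 4}, {1, 3, 4}), ({1, 3, 4}, {1, 3, 5}),
    ({1, 3, 5}, {2, 3, 5}), ({2, 3, 5}, {0, 2, 3})] (by decide +kernel) (by decide +kernel)
  have h₄ := count 4 [({0, 3, 4}, {0, 4, 5}), ({0, 4, 5}, {2, 4, 5}), ({2, 4, 5}, {1, 2, 4}),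
    ({1, 2, 4}, {1, 3, 4}), ({1, 3, 4}, {0, 3, 4})] (by decide +kernel) (by decide +kernel)
  have h₅ := count 5 [({0, 4, 5}, {0, 1, 5}), ({0, 1, 5}, {1, 3, 5}), ({1, 3, 5}, {2, 3, 5}),
    ({2, 3, 5}, {2, 4, 5}), ({2, 4, 5}, {0, 4, 5})] (by decide +kernel) (by decide +kernel)
  obtain ⟨b, hb⟩ := colouring_avoids _ _ _ _ _ _ _ _ _ h₀ h₁ h₂ h₃ h₄ h₅
  have avoids : ∀ F : Finset (Finset ℕ),
      (∀ x ∈ F, decide (x ∈ projectivePlaneSumTorus.sideFaces c f) = b) →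
      ∀ P : List (Finset ℕ × Finset ℕ),
      (∀ q ∈ P.map fun p => (decide (p.1 ∈ projectivePlaneSumTorus.sideFaces c f),
        decide (p.2 ∈ projectivePlaneSumTorus.sideFaces c f)), ¬ (q.1 = b ∧ q.2 = b)) →
      ∀ p ∈ P, ¬ (p.1 ∈ F ∧ p.2 ∈ F) :=
    fun F hF P hP p hp hpF => hP _ (List.mem_map_of_mem hp) ⟨hF _ hpF.1, hF _ hpF.2⟩
  cases b with
  | true =>
    have h := avoids _ fun x hx => decide_eq_true hx
    exact .inl (exists_isCoherent_of_avoids_triangle hA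
      (hb.imp (h pairs035) (.imp (h pairs145) (h pairs234))))
  | false =>
    have h := avoids _ hdisj
    exact .inr (exists_isCoherent_of_avoids_triangle hB
      (hb.imp (h pairs035) (.imp (h pairs145) (h pairs234))))

end Triangulation

/-- There is a triangulation of `N_3` with no NSC separating the surface into the
projective plane `N_1` (capped Euler characteristic 1, nonorientable) and the Klein
bottle `N_2` (capped Euler characteristic 0, nonorientable). -/
theorem exists_triangulation_n3_no_NSC_into_n1_n2 :
    ∃ T : Triangulation, T.IsN 3 ∧
      ∀ c : List ℕ, T.IsCycle c →
        ¬ ∃ f ∈ T.faces, ∃ g ∈ T.faces, ¬ T.SameSide c f g ∧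
          (T.sideEuler c f = 1 ∧ ¬ T.SideOrientable c f) ∧
          (T.sideEuler c g = 0 ∧ ¬ T.SideOrientable c g) := by
  refine ⟨Triangulation.projectivePlaneSumTorus,
    ⟨by rw [Triangulation.euler_projectivePlaneSumTorus]; norm_num,
      Triangulation.not_orientable_projectivePlaneSumTorus⟩, ?_⟩
  rintro c ⟨-, hc, -⟩ ⟨f, -, g, -, hfg, ⟨-, hf⟩, ⟨-, hg⟩⟩
  exact (Triangulation.sideOrientable_or_sideOrientable hc hfg).elim hf hg
end

section
/- There exists a triangulation of the nonorientable surface N_3 which has no noncontractible separating cycle separating the surface into the projective plane N_1 and the torus S_1 (i.e., no NSC whose two capped pieces are homeomorphic to N_1 and S_1, respectively). -/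
open scoped Classical

namespace N3

open Triangulation

/-- The ordered vertex triples of a triangulation of `N₃` with eleven vertices: a Klein bottle
with eight vertices and the six-vertex projective plane, glued along the triangle `{0, 3, 5}`. -/
def triples : List (ℕ × ℕ × ℕ) :=
  [(2, 3, 6), (0, 2, 6), (1, 3, 6), (1, 5, 6), (0, 5, 6), (0, 1, 2), (1, 2, 5), (0, 1, 7),
   (1, 3, 7), (2, 4, 5), (2, 3, 4), (4, 5, 7), (0, 4, 7), (3, 5, 7), (0, 3, 4), (0, 3, 10),
   (3, 5, 9), (3, 8, 10), (3, 8, 9), (0, 5, 8), (5, 8, 10), (5, 9, 10), (0, 8, 9), (0, 9, 10)]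

/-- For each vertex, the indices of the faces around it, in cyclic order. -/
def links : List (List ℕ) :=
  [[1, 5, 7, 12, 14, 15, 23, 22, 19, 4],
   [2, 8, 7, 5, 6, 3],
   [0, 10, 9, 6, 5, 1],
   [0, 10, 14, 15, 17, 18, 16, 13, 8, 2],
   [9, 10, 14, 12, 11],
   [3, 6, 9, 11, 13, 16, 21, 20, 19, 4],
   [0, 1, 4, 3, 2],
   [7, 12, 11, 13, 8],
   [17, 18, 22, 19, 20],
   [16, 18, 22, 23, 21],
   [15, 23, 21, 20, 17]]

/-- The edges, each with the indices of the two faces containing it. -/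
def edgeIncidences : List (Finset ℕ × List ℕ) :=
  [({0, 1}, [5, 7]), ({0, 2}, [1, 5]), ({0, 3}, [14, 15]), ({0, 4}, [12, 14]),
   ({0, 5}, [4, 19]), ({0, 6}, [1, 4]), ({0, 7}, [7, 12]), ({0, 8}, [19, 22]),
   ({0, 9}, [22, 23]), ({0, 10}, [15, 23]), ({1, 2}, [5, 6]), ({1, 3}, [2, 8]),
   ({1, 5}, [3, 6]), ({1, 6}, [2, 3]), ({1, 7}, [7, 8]), ({2, 3}, [0, 10]),
   ({2, 4}, [9, 10]), ({2, 5}, [6, 9]), ({2, 6}, [0, 1]), ({3, 4}, [10, 14]),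
   ({3, 5}, [13, 16]), ({3, 6}, [0, 2]), ({3, 7}, [8, 13]), ({3, 8}, [17, 18]),
   ({3, 9}, [16, 18]), ({3, 10}, [15, 17]), ({4, 5}, [9, 11]), ({4, 7}, [11, 12]),
   ({5, 6}, [3, 4]), ({5, 7}, [11, 13]), ({5, 8}, [19, 20]), ({5, 9}, [16, 21]),
   ({5, 10}, [20, 21]), ({8, 9}, [18, 22]), ({8, 10}, [17, 20]), ({9, 10}, [21, 23])]

/-- The step of the search deciding whether the face with index `face` is selected. -/
structure Step where
  /-- The index of the face. -/
  face : ℕ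
  /-- Earlier adjacent faces whose listed orientation agrees with that of the face. -/
  agree : List ℕ
  /-- Earlier adjacent faces whose listed orientation disagrees with that of the face. -/
  disagree : List ℕ
  /-- At the vertices of the face, the nearest earlier faces in both directions around the
  vertex, and the remaining earlier faces there. -/
  corners : List (ℕ × ℕ × List ℕ)

/-- The steps of the search, one for each face. -/
def steps : List Step :=
  [⟨0, [], [], []⟩,
   ⟨1, [0], [], []⟩,
   ⟨2, [], [0], []⟩,
   ⟨3, [], [2], [(1, 2, [0])]⟩,
   ⟨4, [], [1, 3], [(1, 3, [2, 0])]⟩,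
   ⟨5, [1], [], []⟩,
   ⟨6, [3], [5], [(5, 3, [2]), (0, 5, [1])]⟩,
   ⟨7, [], [5], [(5, 4, [1]), (2, 5, [6, 3])]⟩,
   ⟨8, [7], [2], [(2, 7, [5, 6, 3])]⟩,
   ⟨9, [6], [], [(0, 6, [5, 1]), (6, 4, [3])]⟩,
   ⟨10, [9], [0], [(0, 9, [6, 5, 1]), (0, 8, [2])]⟩,
   ⟨11, [], [9], [(9, 4, [3, 6])]⟩,
   ⟨12, [11], [7], [(7, 4, [1, 5]), (10, 11, [9]), (7, 11, [8])]⟩,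
   ⟨13, [8], [11], [(10, 8, [2, 0]), (11, 4, [3, 6, 9]), (11, 8, [7, 12])]⟩,
   ⟨14, [12], [10], [(12, 4, [1, 5, 7]), (10, 13, [8, 2, 0]), (10, 12, [11, 9])]⟩,
   ⟨15, [], [14], [(14, 4, [1, 5, 7, 12]), (14, 13, [8, 2, 0, 10])]⟩,
   ⟨16, [], [13], [(15, 13, [8, 2, 0, 10, 14]), (13, 4, [3, 6, 9, 11])]⟩,
   ⟨17, [15], [], [(15, 16, [13, 8, 2, 0, 10, 14])]⟩,
   ⟨18, [], [17, 16], [(17, 16, [13, 8, 2, 0, 10, 14, 15])]⟩,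
   ⟨19, [], [4], [(15, 4, [1, 5, 7, 12, 14]), (16, 4, [3, 6, 9, 11, 13])]⟩,
   ⟨20, [], [19, 17], [(16, 19, [4, 3, 6, 9, 11, 13]), (19, 17, [18])]⟩,
   ⟨21, [], [16, 20], [(16, 20, [19, 4, 3, 6, 9, 11, 13]), (15, 20, [17])]⟩,
   ⟨22, [19], [18], [(15, 19, [4, 1, 5, 7, 12, 14]), (18, 19, [20, 17]), (18, 21, [16])]⟩,
   ⟨23, [22], [15, 21],
     [(15, 22, [19, 4, 1, 5, 7, 12, 14]), (22, 21, [16, 18]), (15, 21, [20, 17])]⟩]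

/-- The one-element lists of face indices. -/
def faceIndices : List (List ℕ) :=
  [[0], [1], [2], [3], [4], [5], [6], [7], [8], [9], [10], [11], [12], [13], [14], [15], [16], [17],
   [18], [19], [20], [21], [22], [23]]

/-- The bit mask of a list of indices. -/
def maskOf (l : List ℕ) : ℕ :=
  List.rec 0 (fun i _ ih => Nat.lor (Nat.pow 2 i) ih) l

/-- Whether the bit mask `n` contains none of the listed indices. -/
def avoids (n : ℕ) (l : List ℕ) : Bool := Nat.beq (Nat.land n (maskOf l)) 0

/-- The number of lists containing an index of the bit mask `n`. -/
def countMeeting (n : ℕ) (ls : List (List ℕ)) : ℕ :=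
  List.rec 0 (fun l _ ih => Bool.rec (Nat.succ ih) ih (avoids n l)) ls

/-- The Euler characteristic of the set of faces with mask `n` is not `-1`. -/
def leafOK (n : ℕ) : Bool :=
  Bool.rec true false
    (Nat.beq (Nat.succ (Nat.add (countMeeting n links) (countMeeting n faceIndices)))
      (countMeeting n (edgeIncidences.map Prod.snd)))

/-- Adding a face to the set with mask `n` does not produce two separated
sectors of that set at a common vertex. -/
def cornersOK (n : ℕ) (cs : List (ℕ × ℕ × List ℕ)) : Bool :=
  List.rec true
    (fun c _ ih => Bool.rec ih (Bool.rec false ih (avoids n c.2.2)) (avoids n [c.1, c.2.1])) cs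

/-- Exhaustive search over the selections of faces with an orientation, the first selected face
being oriented as listed: every admissible selection passes `leafOK`. Here `A`, `P` and `N` are
the masks of the faces that are not selected, selected with the listed orientation, and selected
with the opposite orientation. It is written with recursors to keep kernel reduction fast. -/
def search (sts : List Step) : ℕ → ℕ → ℕ → Bool :=
  List.rec (motive := fun _ => ℕ → ℕ → ℕ → Bool)
    (fun _ P N => leafOK (Nat.lor P N))
    (fun st _ ih A P N =>
      Bool.rec false
        (Bool.rec true
          (Bool.rec false
            (Bool.rec
              (Bool.rec true
                (Bool.rec true (ih A P (Nat.lor N (Nat.pow 2 st.face))) (avoids N st.disagree))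
                (avoids P st.agree))
              true (Nat.beq P 0))
            (Bool.rec true
              (Bool.rec true (ih A (Nat.lor P (Nat.pow 2 st.face)) N) (avoids N st.agree))
              (avoids P st.disagree)))
          (cornersOK (Nat.lor P N) st.corners))
        (Bool.rec true (ih (Nat.lor A (Nat.pow 2 st.face)) P N) (cornersOK A st.corners))) sts

theorem search_steps : search steps 0 0 0 = true := by
  decide +kernel

/-- The face with index `i`. -/
def face (i : ℕ) : Finset ℕ :=
  {(triples.getD i (0, 0, 0)).1, (triples.getD i (0, 0, 0)).2.1, (triples.getD i (0, 0, 0)).2.2}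

/-- The set of all faces. -/
def faceSet : Finset (Finset ℕ) := (Finset.range 24).image face

/-- The vertices, each with the indices of the faces around it. -/
def vertexIncidences : List (ℕ × List ℕ) := (List.range 11).zip links

/-- The faces, each with its own index. -/
def faceIncidences : List (Finset ℕ × List ℕ) := ((List.range 24).map face).zip faceIndices

/-- A path in the dual graph through all faces. -/
def dualPath : List ℕ :=
  [0, 10, 9, 6, 3, 2, 8, 7, 5, 1, 4, 19, 22, 23, 15, 14, 12, 11, 13, 16, 18, 17, 20, 21]

/-- The edges shared by consecutive faces of a list of face indices. -/
def sharedEdges : List ℕ → List (Finset ℕ)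
  | i :: j :: l => (face i ∩ face j) :: sharedEdges (j :: l)
  | _ => []

theorem mem_faceSet {f : Finset ℕ} : f ∈ faceSet ↔ ∃ i < 24, face i = f := by
  simp [faceSet]

theorem face_mem {i : ℕ} (hi : i < 24) : face i ∈ faceSet := mem_faceSet.2 ⟨i, hi, rfl⟩

theorem card_face : ∀ i < 24, (face i).card = 3 := by decide +kernel

theorem card_filter_edge : ∀ i < 24, ∀ e ∈ Finset.powersetCard 2 (face i),
    (faceSet.filter (fun f => e ⊆ f)).card = 2 := by decide +kernel

theorem vertexIncidences_chain : ∀ q ∈ vertexIncidences,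
    q.2.IsChain (fun i j => i < 24 ∧ j < 24 ∧ q.1 ∈ face i ∧ q.1 ∈ face j ∧
      (face i ∩ face j).card = 2) := by decide +kernel

theorem sharedEdges_nodup : ∀ q ∈ vertexIncidences,
    (sharedEdges q.2).Nodup ∧ ∀ e ∈ sharedEdges q.2, q.1 ∈ e := by decide +kernel

theorem dualPath_chain :
    dualPath.IsChain (fun i j => i < 24 ∧ j < 24 ∧ (face i ∩ face j).card = 2) := by
  decide +kernel

theorem mem_dualPath : ∀ i < 24, i ∈ dualPath := by decide +kernel

theorem vertexIncidences_sound : ∀ q ∈ vertexIncidences, ∀ i ∈ q.2, i < 24 ∧ q.1 ∈ face i := by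
  decide +kernel

theorem vertexIncidences_complete : ∀ i < 24, ∀ v ∈ face i,
    ∃ q ∈ vertexIncidences, q.1 = v ∧ i ∈ q.2 := by decide +kernel

theorem vertexIncidences_nodup : (vertexIncidences.map Prod.fst).Nodup := by decide +kernel

theorem edgeIncidences_sound : ∀ q ∈ edgeIncidences, ∀ i ∈ q.2,
    i < 24 ∧ q.1 ∈ Finset.powersetCard 2 (face i) := by decide +kernel

theorem edgeIncidences_complete : ∀ i < 24, ∀ e ∈ Finset.powersetCard 2 (face i),
    ∃ q ∈ edgeIncidences, q.1 = e ∧ i ∈ q.2 := by decide +kernel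

theorem edgeIncidences_nodup : (edgeIncidences.map Prod.fst).Nodup := by decide +kernel

theorem faceIncidences_sound : ∀ q ∈ faceIncidences, ∀ i ∈ q.2, i < 24 ∧ q.1 = face i := by
  decide +kernel

theorem faceIncidences_complete : ∀ i < 24, ∃ q ∈ faceIncidences, q.1 = face i ∧ i ∈ q.2 := by
  decide +kernel

theorem faceIncidences_nodup : (faceIncidences.map Prod.fst).Nodup := by decide +kernel

theorem reflTransGen_of_isChain {α : Type*} {r : α → α → Prop} (hr : ∀ x y, r x y → r y x) :
    ∀ {l : List α}, l.IsChain r → ∀ x ∈ l, ∀ y ∈ l, Relation.ReflTransGen r x y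
  | [], _, x, hx, _, _ => absurd hx (by simp)
  | [a], _, x, hx, y, hy => by
    simp only [List.mem_singleton] at hx hy
    rw [hx, hy]
  | a :: b :: l, h, x, hx, y, hy => by
    rw [List.isChain_cons_cons] at h
    have ih := reflTransGen_of_isChain hr h.2
    have hb : b ∈ b :: l := by simp
    rcases List.mem_cons.1 hx with hx' | hx' <;> rcases List.mem_cons.1 hy with hy' | hy'
    · rw [hx', hy']
    · exact hx' ▸ (ih b hb y hy').head h.1
    · exact hy' ▸ (ih x hx' b hb).tail (hr _ _ h.1)
    · exact ih x hx' y hy'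

/-- The triangulation of `N₃` with the faces listed in `triples`. -/
def triangulation : Triangulation where
  faces := faceSet
  faces_nonempty := ⟨face 0, face_mem (by norm_num)⟩
  card_eq_three f hf := by
    obtain ⟨i, hi, rfl⟩ := mem_faceSet.1 hf
    exact card_face i hi
  edge_in_two_faces e he := by
    rintro ⟨f, hf, hef⟩
    obtain ⟨i, hi, rfl⟩ := mem_faceSet.1 hf
    exact card_filter_edge i hi e (Finset.mem_powersetCard.2 ⟨hef, he⟩)
  link_connected v f hf g hg hvf hvg := by
    obtain ⟨i, hi, rfl⟩ := mem_faceSet.1 hf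
    obtain ⟨j, hj, rfl⟩ := mem_faceSet.1 hg
    obtain ⟨q, hq, rfl, hiq⟩ := vertexIncidences_complete i hi v hvf
    obtain ⟨q', hq', hv, hjq⟩ := vertexIncidences_complete j hj _ hvg
    obtain rfl : q' = q := List.inj_on_of_nodup_map vertexIncidences_nodup hq' hq hv
    have := reflTransGen_of_isChain (fun x y h => by
      rwa [Finset.inter_comm, and_left_comm, and_left_comm (a := _ ∈ face y)])
      (vertexIncidences_chain _ hq) i hiq j hjq
    exact this.lift face fun x y h => ⟨face_mem h.1, face_mem h.2.1, h.2.2⟩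
  face_connected f hf g hg := by
    obtain ⟨i, hi, rfl⟩ := mem_faceSet.1 hf
    obtain ⟨j, hj, rfl⟩ := mem_faceSet.1 hg
    have := reflTransGen_of_isChain (fun x y h => by rwa [Finset.inter_comm, and_left_comm])
      dualPath_chain i (mem_dualPath i hi) j (mem_dualPath j hj)
    exact this.lift face fun x y h => ⟨face_mem h.1, face_mem h.2.1, h.2.2⟩

/-! ### Soundness of the search -/

theorem testBit_maskOf (l : List ℕ) (i : ℕ) : (maskOf l).testBit i = decide (i ∈ l) := by
  induction l with
  | nil => simp [maskOf]
  | cons j l ih =>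
    change (2 ^ j ||| maskOf l).testBit i = _
    rw [Nat.testBit_or, ih, Nat.testBit_two_pow]
    simp [eq_comm]

theorem avoids_iff {n : ℕ} {l : List ℕ} : avoids n l = true ↔ ∀ i ∈ l, n.testBit i = false := by
  change Nat.beq (n &&& maskOf l) 0 = true ↔ _
  rw [Nat.beq_eq]
  constructor
  · intro h i hi
    have := congrArg (·.testBit i) h
    simpa [Nat.testBit_and, testBit_maskOf, hi] using this
  · intro h
    refine Nat.eq_of_testBit_eq fun i => ?_
    simp only [Nat.testBit_and, testBit_maskOf, Nat.zero_testBit, Bool.and_eq_false_iff,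
      decide_eq_false_iff_not]
    exact (em (i ∈ l)).imp (h i) id

/-- The bit mask `n` represents the indices below `k` selected by `b`. -/
def Represents (n : ℕ) (b : ℕ → Bool) (k : ℕ) : Prop :=
  ∀ i, n.testBit i = (decide (i < k) && b i)

theorem Represents.avoids_iff {n k : ℕ} {b : ℕ → Bool} (h : Represents n b k) {l : List ℕ}
    (hl : ∀ i ∈ l, i < k) : avoids n l = true ↔ ∀ i ∈ l, b i = false := by
  rw [N3.avoids_iff]
  refine forall₂_congr fun i hi => ?_
  simp [h i, hl i hi]

theorem Represents.insert {n k : ℕ} {b : ℕ → Bool} (h : Represents n b k) (hk : b k = true) :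
    Represents (Nat.lor n (Nat.pow 2 k)) b (k + 1) := by
  intro i
  change (n ||| 2 ^ k).testBit i = _
  rw [Nat.testBit_or, h i, Nat.testBit_two_pow]
  rcases lt_trichotomy i k with hik | rfl | hik
  · simp [hik, hik.ne', Nat.lt_succ_of_lt hik]
  · simp [hk]
  · simp [hik.not_gt, hik.ne, Nat.not_lt.2 hik]

theorem Represents.skip {n k : ℕ} {b : ℕ → Bool} (h : Represents n b k) (hk : b k = false) :
    Represents n b (k + 1) := by
  intro i
  rw [h i]
  rcases lt_trichotomy i k with hik | rfl | hik
  · simp [hik, Nat.lt_succ_of_lt hik]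
  · simp [hk]
  · simp [hik.not_gt, Nat.not_lt.2 hik]

theorem Represents.lor {m n k : ℕ} {b p : ℕ → Bool}
    (hm : Represents m (fun i => b i && p i) k) (hn : Represents n (fun i => b i && !p i) k) :
    Represents (Nat.lor m n) b k := by
  intro i
  change (m ||| n).testBit i = _
  rw [Nat.testBit_or, hm i, hn i]
  dsimp only
  cases b i <;> cases p i <;> simp

/-- The constraints tested by a step hold for the face with index `k`, where `b` selects faces
and `p` describes their orientations. -/
structure Step.Holds (st : Step) (b p : ℕ → Bool) (k : ℕ) : Prop where
  face_eq : st.face = k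
  agree_lt : ∀ i ∈ st.agree, i < k
  disagree_lt : ∀ i ∈ st.disagree, i < k
  corners_lt : ∀ c ∈ st.corners, c.1 < k ∧ c.2.1 < k ∧ ∀ i ∈ c.2.2, i < k
  agree : ∀ i ∈ st.agree, b k = true → b i = true → p i = p k
  disagree : ∀ i ∈ st.disagree, b k = true → b i = true → p i = !p k
  corners : ∀ c ∈ st.corners, b c.1 ≠ b k → b c.2.1 ≠ b k → ∀ i ∈ c.2.2, b i ≠ b k
  first : b k = true → p k = false → ∃ i < k, b i = true ∧ p i = true

theorem cornersOK_of_forall {n k : ℕ} {b : ℕ → Bool} (hn : Represents n b k) :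
    ∀ {cs : List (ℕ × ℕ × List ℕ)},
      (∀ c ∈ cs, c.1 < k ∧ c.2.1 < k ∧ ∀ i ∈ c.2.2, i < k) →
      (∀ c ∈ cs, b c.1 = false → b c.2.1 = false → ∀ i ∈ c.2.2, b i = false) →
      cornersOK n cs = true
  | [], _, _ => rfl
  | c :: cs, hlt, h => by
    have ih : cornersOK n cs = true := cornersOK_of_forall hn
      (fun d hd => hlt d (List.mem_cons_of_mem _ hd)) (fun d hd => h d (List.mem_cons_of_mem _ hd))
    have hc := hlt c (by simp)
    change (Bool.rec (cornersOK n cs) (Bool.rec false (cornersOK n cs) (avoids n c.2.2))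
      (avoids n [c.1, c.2.1]) : Bool) = true
    rw [ih]
    cases h₁ : avoids n [c.1, c.2.1]
    · rfl
    · rw [hn.avoids_iff (by simpa using ⟨hc.1, hc.2.1⟩)] at h₁
      rw [(hn.avoids_iff hc.2.2).2 (h c (by simp) (h₁ _ (by simp)) (h₁ _ (by simp)))]

theorem exists_leafOK_of_search {b p : ℕ → Bool} :
    ∀ (sts : List Step) {k A P N : ℕ},
      (∀ (j : ℕ) (st : Step), sts[j]? = some st → st.Holds b p (k + j)) →
      Represents A (fun i => !b i) k → Represents P (fun i => b i && p i) k →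
      Represents N (fun i => b i && !p i) k → search sts A P N = true →
      ∃ n, Represents n b (k + sts.length) ∧ leafOK n = true
  | [], _, _, P, N, _, _, hP, hN, h => ⟨Nat.lor P N, hP.lor hN, h⟩
  | st :: rest, k, A, P, N, hst, hA, hP, hN, h => by
    have hk : st.Holds b p k := hst 0 st rfl
    have hrest : ∀ (j : ℕ) (st : Step), rest[j]? = some st → st.Holds b p (k + 1 + j) :=
        fun j st' hj => by
      have := hst (j + 1) st' (by simpa using hj)
      rwa [Nat.add_right_comm]
    have key : ∀ {A' P' N'}, Represents A' (fun i => !b i) (k + 1) →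
        Represents P' (fun i => b i && p i) (k + 1) →
        Represents N' (fun i => b i && !p i) (k + 1) → search rest A' P' N' = true →
        ∃ n, Represents n b (k + (st :: rest).length) ∧ leafOK n = true := by
      intro A' P' N' hA' hP' hN' h'
      have := exists_leafOK_of_search rest hrest hA' hP' hN' h'
      rwa [Nat.add_assoc, Nat.add_comm 1] at this
    have hcons : search (st :: rest) A P N =
        ((!cornersOK A st.corners || search rest (Nat.lor A (Nat.pow 2 st.face)) P N) &&
        (!cornersOK (Nat.lor P N) st.corners ||
          ((!avoids P st.disagree || (!avoids N st.agree ||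
            search rest A (Nat.lor P (Nat.pow 2 st.face)) N)) &&
          (Nat.beq P 0 || (!avoids P st.agree || (!avoids N st.disagree ||
            search rest A P (Nat.lor N (Nat.pow 2 st.face)))))))) := by
      change (Bool.rec false
        (Bool.rec true
          (Bool.rec false
            (Bool.rec
              (Bool.rec true
                (Bool.rec true (search rest A P (Nat.lor N (Nat.pow 2 st.face)))
                  (avoids N st.disagree))
                (avoids P st.agree))
              true (Nat.beq P 0))
            (Bool.rec true
              (Bool.rec true (search rest A (Nat.lor P (Nat.pow 2 st.face)) N)
                (avoids N st.agree))
              (avoids P st.disagree)))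
          (cornersOK (Nat.lor P N) st.corners))
        (Bool.rec true (search rest (Nat.lor A (Nat.pow 2 st.face)) P N)
          (cornersOK A st.corners)) : Bool) = _
      cases cornersOK A st.corners <;> cases cornersOK (Nat.lor P N) st.corners <;>
        cases avoids P st.disagree <;> cases avoids N st.agree <;> cases Nat.beq P 0 <;>
        cases avoids P st.agree <;> cases avoids N st.disagree <;>
        cases search rest (Nat.lor A (Nat.pow 2 st.face)) P N <;>
        cases search rest A (Nat.lor P (Nat.pow 2 st.face)) N <;> rfl
    rw [hcons, hk.face_eq, Bool.and_eq_true] at h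
    cases hb : b k
    · have hc : cornersOK A st.corners = true :=
        cornersOK_of_forall hA hk.corners_lt fun c hc h₁ h₂ i hi => by
          have := hk.corners c hc
          simp_all
      have h₁ := h.1
      rw [hc] at h₁
      exact key (hA.insert (by simp [hb])) (hP.skip (by simp [hb])) (hN.skip (by simp [hb]))
        (by simpa using h₁)
    · have hc : cornersOK (Nat.lor P N) st.corners = true :=
        cornersOK_of_forall (hP.lor hN) hk.corners_lt fun c hc h₁ h₂ i hi => by
          have := hk.corners c hc
          simp_all
      have h₁ := h.2
      rw [hc, Bool.not_true, Bool.false_or, Bool.and_eq_true] at h₁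
      have ha := hk.agree
      have hd := hk.disagree
      cases hp : p k
      · have h₂ := h₁.2
        have h0 : Nat.beq P 0 = false := by
          obtain ⟨i, hik, hbi, hpi⟩ := hk.first hb hp
          rw [Bool.eq_false_iff, ne_eq, Nat.beq_eq]
          rintro rfl
          simpa [hik, hbi, hpi] using hP i
        rw [h0, (hP.avoids_iff hk.agree_lt).2 (by
            intro i hi; have := ha i hi hb; cases h : b i <;> simp_all),
          (hN.avoids_iff hk.disagree_lt).2 (by
            intro i hi; have := hd i hi hb; cases h : b i <;> simp_all)] at h₂
        exact key (hA.skip (by simp [hb])) (hP.skip (by simp [hp]))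
          (hN.insert (by simp [hb, hp])) (by simpa using h₂)
      · have h₂ := h₁.1
        rw [(hN.avoids_iff hk.agree_lt).2 (by
            intro i hi; have := ha i hi hb; cases h : b i <;> simp_all),
          (hP.avoids_iff hk.disagree_lt).2 (by
            intro i hi; have := hd i hi hb; cases h : b i <;> simp_all)] at h₂
        exact key (hA.skip (by simp [hb])) (hP.insert (by simp [hb, hp]))
          (hN.skip (by simp [hp])) (by simpa using h₂)

/-! ### The Euler characteristic of a set of faces -/

theorem card_eq_countMeeting {α : Type*} {n : ℕ} {ol : List (α × List ℕ)}
    (hnodup : (ol.map Prod.fst).Nodup) {S : Finset α}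
    (hS : ∀ x, x ∈ S ↔ ∃ q ∈ ol, q.1 = x ∧ ∃ i ∈ q.2, n.testBit i = true) :
    S.card = countMeeting n (ol.map Prod.snd) := by
  have hcount : ∀ l : List (α × List ℕ), countMeeting n (l.map Prod.snd) =
      (l.filter (fun q => !avoids n q.2)).length := by
    intro l
    induction l with
    | nil => rfl
    | cons q l ih =>
      change (Bool.rec (Nat.succ (countMeeting n (l.map Prod.snd)))
        (countMeeting n (l.map Prod.snd)) (avoids n q.2) : ℕ) = _
      rw [ih]
      cases h : avoids n q.2 <;> simp [h]
  have hsub : ((ol.filter (fun q => !avoids n q.2)).map Prod.fst).Nodup :=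
    hnodup.sublist (List.filter_sublist.map _)
  rw [hcount, ← List.length_map (f := Prod.fst), ← List.toFinset_card_of_nodup hsub]
  congr 1
  ext x
  have hav : ∀ q : α × List ℕ, avoids n q.2 = false ↔ ∃ i ∈ q.2, n.testBit i = true := by
    intro q
    rw [Bool.eq_false_iff, ne_eq, avoids_iff]
    push Not
    simp
  simp only [hS, List.mem_toFinset, List.mem_map, List.mem_filter, Bool.not_eq_true', hav]
  exact ⟨fun ⟨q, h₁, h₂, h₃⟩ => ⟨q, ⟨h₁, h₃⟩, h₂⟩, fun ⟨q, ⟨h₁, h₃⟩, h₂⟩ => ⟨q, h₁, h₂, h₃⟩⟩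

theorem card_eq_countMeeting_of_incidence {α : Type*} {B : Finset (Finset ℕ)} (hB : B ⊆ faceSet)
    {n : ℕ} (hn : Represents n (fun i => decide (face i ∈ B)) 24) {ol : List (α × List ℕ)}
    {r : α → Finset ℕ → Prop} (hnodup : (ol.map Prod.fst).Nodup)
    (sound : ∀ q ∈ ol, ∀ i ∈ q.2, i < 24 ∧ r q.1 (face i))
    (complete : ∀ i < 24, ∀ x, r x (face i) → ∃ q ∈ ol, q.1 = x ∧ i ∈ q.2)
    {S : Finset α} (hS : ∀ x, x ∈ S ↔ ∃ f ∈ B, r x f) :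
    S.card = countMeeting n (ol.map Prod.snd) := by
  refine card_eq_countMeeting hnodup fun x => ?_
  rw [hS]
  constructor
  · rintro ⟨f, hf, hr⟩
    obtain ⟨i, hi, rfl⟩ := mem_faceSet.1 (hB hf)
    obtain ⟨q, hq, rfl, hiq⟩ := complete i hi x hr
    exact ⟨q, hq, rfl, i, hiq, by simp [hn i, hi, hf]⟩
  · rintro ⟨q, hq, rfl, i, hi, hbit⟩
    have := sound q hq i hi
    exact ⟨face i, by simpa [hn i, this.1] using hbit, this.2⟩

theorem euler_ne_of_leafOK {B : Finset (Finset ℕ)} (hB : B ⊆ faceSet) {n : ℕ}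
    (hn : Represents n (fun i => decide (face i ∈ B)) 24) (h : leafOK n = true) :
    ((vertsOf B).card : ℤ) - (edgesOf B).card + B.card ≠ -1 := by
  have hV : (vertsOf B).card = countMeeting n links :=
    card_eq_countMeeting_of_incidence hB hn (r := fun v f => v ∈ f) vertexIncidences_nodup
      vertexIncidences_sound vertexIncidences_complete fun v => by simp [vertsOf, Finset.mem_sup]
  have hE : (edgesOf B).card = countMeeting n (edgeIncidences.map Prod.snd) :=
    card_eq_countMeeting_of_incidence hB hn (r := fun e f => e ∈ Finset.powersetCard 2 f)
      edgeIncidences_nodup edgeIncidences_sound edgeIncidences_complete fun e => by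
        simp only [edgesOf, Finset.mem_filter, Finset.mem_powersetCard]
        constructor
        · rintro ⟨⟨-, h₂⟩, f, hf, hef⟩
          exact ⟨f, hf, hef, h₂⟩
        · rintro ⟨f, hf, hef, h₂⟩
          exact ⟨⟨hef.trans (Finset.le_sup (f := id) hf), h₂⟩, f, hf, hef⟩
  have hF : B.card = countMeeting n faceIndices :=
    card_eq_countMeeting_of_incidence hB hn (r := fun x f => x = f) faceIncidences_nodup
      faceIncidences_sound (fun i hi x hx => hx ▸ faceIncidences_complete i hi) fun x => by simp
  have hne : countMeeting n links + countMeeting n faceIndices + 1 ≠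
      countMeeting n (edgeIncidences.map Prod.snd) := by
    intro heq
    have : Nat.beq (Nat.succ (Nat.add (countMeeting n links) (countMeeting n faceIndices)))
      (countMeeting n (edgeIncidences.map Prod.snd)) = true := Nat.beq_eq.mpr heq
    unfold leafOK at h
    rw [this] at h
    exact absurd h (by decide)
  rw [hV, hE, hF]
  omega

/-! ### Changes of side around a vertex -/

/-- The number of changes of value along the list, starting from a given value. -/
def changes : Bool → List Bool → ℕ
  | _, [] => 0
  | c, x :: l => (if c = x then 0 else 1) + changes x l

theorem changes_le_cons (c x : Bool) (l : List Bool) : changes c l ≤ changes c (x :: l) := by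
  cases l with
  | nil => simp [changes]
  | cons y l =>
    simp only [changes]
    cases c <;> cases x <;> cases y <;> simp <;> omega

theorem changes_le_of_sublist {l₁ l₂ : List Bool} (h : l₁.Sublist l₂) :
    ∀ c, changes c l₁ ≤ changes c l₂ := by
  induction h with
  | slnil => exact fun _ => le_rfl
  | cons x _ ih => exact fun c => (ih c).trans (changes_le_cons c x _)
  | cons_cons x _ ih => exact fun c => Nat.add_le_add_left (ih x) _

theorem changes_le_sharedEdges {b : ℕ → Bool} {C : Finset (Finset ℕ)} :
    ∀ {l : List ℕ} {i : ℕ}, (i :: l).IsChain (fun i j => b i ≠ b j → face i ∩ face j ∈ C) →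
      changes (b i) (l.map b) ≤ ((sharedEdges (i :: l)).filter (· ∈ C)).length
  | [], _, _ => le_rfl
  | j :: l, i, h => by
    rw [List.isChain_cons_cons] at h
    have ih := changes_le_sharedEdges h.2
    simp only [List.map_cons, changes, sharedEdges, List.filter_cons]
    by_cases hij : b i = b j
    · split_ifs <;> simp <;> omega
    · simp [hij, h.1 hij]
      omega

theorem not_alternating {B C : Finset (Finset ℕ)}
    (hC : ∀ v, (C.filter (fun e => v ∈ e)).card ≤ 2)
    (hbd : ∀ f ∈ faceSet, ∀ g ∈ faceSet, (f ∩ g).card = 2 → f ∈ B → g ∉ B → f ∩ g ∈ C)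
    {L : List ℕ} (hL : L ∈ links) {w x y z : ℕ} (hsub : [w, x, y, z].Sublist L)
    (hwx : decide (face w ∈ B) ≠ decide (face x ∈ B))
    (hxy : decide (face x ∈ B) ≠ decide (face y ∈ B))
    (hyz : decide (face y ∈ B) ≠ decide (face z ∈ B)) : False := by
  obtain ⟨q, hq, rfl⟩ : ∃ q ∈ vertexIncidences, q.2 = L := by
    have : vertexIncidences.map Prod.snd = links := rfl
    simpa [← this] using hL
  have hchain := vertexIncidences_chain q hq
  obtain ⟨hnodup, hmem⟩ := sharedEdges_nodup q hq
  generalize hl : q.2 = l at *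
  set b : ℕ → Bool := fun i => decide (face i ∈ B)
  cases l with
  | nil => simp at hsub
  | cons i l =>
    have h₁ := changes_le_sharedEdges (b := b) (C := C) (hchain.imp fun i j h hb => by
      by_cases hi : face i ∈ B
      · exact hbd _ (face_mem h.1) _ (face_mem h.2.1) h.2.2.2.2 hi (by simpa [b, hi] using hb)
      · rw [Finset.inter_comm]
        exact hbd _ (face_mem h.2.1) _ (face_mem h.1) (by rw [Finset.inter_comm]; exact h.2.2.2.2)
          (by simpa [b, hi] using hb) hi)
    have h₂ : ((sharedEdges (i :: l)).filter (· ∈ C)).length ≤ 2 := by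
      rw [← List.toFinset_card_of_nodup (hnodup.filter _)]
      refine (Finset.card_le_card fun e he => ?_).trans (hC q.1)
      simp only [List.mem_toFinset, List.mem_filter, decide_eq_true_eq] at he
      exact Finset.mem_filter.2 ⟨he.2, hmem e he.1⟩
    have h₃ := changes_le_of_sublist (hsub.map b) (b i)
    simp only [List.map_cons, List.map_nil, changes, if_true] at h₃
    rw [if_neg hwx, if_neg hxy, if_neg hyz] at h₃
    omega

/-! ### Orientations -/

theorem mem_dedges_of_pair {a b c : ℕ} (hcard : ({a, b, c} : Finset ℕ).card = 3)
    {t : ℕ × ℕ × ℕ} (ht : ({t.1, t.2.1, t.2.2} : Finset ℕ) = {a, b, c}) {e : ℕ × ℕ}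
    (he : e ∈ dedges (a, b, c)) :
    if (a, b) ∈ dedges t then e ∈ dedges t else e.swap ∈ dedges t := by
  obtain ⟨x, y, z⟩ := t
  obtain ⟨u, v⟩ := e
  have hab : a ≠ b := by rintro rfl; have := Finset.card_le_two (a := a) (b := c); simp_all
  have hac : a ≠ c := by
    rintro rfl
    have := Finset.card_le_two (a := b) (b := a)
    rw [Finset.insert_eq_of_mem (by simp)] at hcard
    omega
  have hbc : b ≠ c := by
    rintro rfl
    have := Finset.card_le_two (a := a) (b := b)
    simp at hcard
    omega
  have ha : a ∈ ({x, y, z} : Finset ℕ) := by simp [ht]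
  have hb : b ∈ ({x, y, z} : Finset ℕ) := by simp [ht]
  have hc : c ∈ ({x, y, z} : Finset ℕ) := by simp [ht]
  simp only [dedges, Finset.mem_insert, Finset.mem_singleton, Prod.mk.injEq, Prod.swap_prod_mk]
    at *
  grind

/-- Whether the orientation `σ` of the face with index `i` is the listed one. -/
noncomputable def sign (σ : Finset ℕ → ℕ × ℕ × ℕ) (i : ℕ) : Bool :=
  decide (((triples.getD i (0, 0, 0)).1, (triples.getD i (0, 0, 0)).2.1) ∈ dedges (σ (face i)))

theorem mem_dedges_of_sign {B : Finset (Finset ℕ)} {σ : Finset ℕ → ℕ × ℕ × ℕ}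
    (hσ : IsCoherent B σ) {i : ℕ} (hi : i < 24) (hiB : face i ∈ B) {e : ℕ × ℕ}
    (he : e ∈ dedges (triples.getD i (0, 0, 0))) :
    if sign σ i = true then e ∈ dedges (σ (face i)) else e.swap ∈ dedges (σ (face i)) := by
  have := mem_dedges_of_pair (card_face i hi) (hσ.1 _ hiB) he
  simp only [sign, decide_eq_true_eq]
  exact this

theorem sign_ne {B : Finset (Finset ℕ)} {σ : Finset ℕ → ℕ × ℕ × ℕ} (hσ : IsCoherent B σ)
    {i j : ℕ} (hi : i < 24) (hj : j < 24) (hiB : face i ∈ B) (hjB : face j ∈ B)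
    (hne : face i ≠ face j) {e : ℕ × ℕ} (hei : e ∈ dedges (triples.getD i (0, 0, 0)))
    (hej : e ∈ dedges (triples.getD j (0, 0, 0))) : sign σ i = !sign σ j := by
  have h₁ := mem_dedges_of_sign hσ hi hiB hei
  have h₂ := mem_dedges_of_sign hσ hj hjB hej
  have hd := Finset.disjoint_left.1 (hσ.2 _ hiB _ hjB hne)
  cases hsi : sign σ i <;> cases hsj : sign σ j <;> simp only [hsi, hsj] at h₁ h₂
  · exact absurd h₂ (hd h₁)
  · rfl
  · rfl
  · exact absurd h₂ (hd h₁)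

theorem sign_eq {B : Finset (Finset ℕ)} {σ : Finset ℕ → ℕ × ℕ × ℕ} (hσ : IsCoherent B σ)
    {i j : ℕ} (hi : i < 24) (hj : j < 24) (hiB : face i ∈ B) (hjB : face j ∈ B)
    (hne : face i ≠ face j) {e : ℕ × ℕ} (hei : e ∈ dedges (triples.getD i (0, 0, 0)))
    (hej : e.swap ∈ dedges (triples.getD j (0, 0, 0))) : sign σ i = sign σ j := by
  have h₁ := mem_dedges_of_sign hσ hi hiB hei
  have h₂ := mem_dedges_of_sign hσ hj hjB hej
  have hd := Finset.disjoint_left.1 (hσ.2 _ hiB _ hjB hne)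
  cases hsi : sign σ i <;> cases hsj : sign σ j <;>
    simp only [hsi, hsj, Prod.swap_swap] at h₁ h₂
  · rfl
  · exact absurd h₂ (hd h₁)
  · exact absurd h₂ (hd h₁)
  · rfl

/-! ### The constraints hold for the sides of a cycle -/

/-- The combinatorial facts about the faces justifying the constraints of a step. -/
def Step.Valid (st : Step) (k : ℕ) : Prop :=
  k < 24 ∧ st.face = k ∧
  (∀ i ∈ st.agree, i < k ∧ N3.face i ≠ N3.face k ∧ ∃ e ∈ dedges (triples.getD i (0, 0, 0)),
    e.swap ∈ dedges (triples.getD k (0, 0, 0))) ∧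
  (∀ i ∈ st.disagree, i < k ∧ N3.face i ≠ N3.face k ∧ ∃ e ∈ dedges (triples.getD i (0, 0, 0)),
    e ∈ dedges (triples.getD k (0, 0, 0))) ∧
  ∀ c ∈ st.corners, c.1 < k ∧ c.2.1 < k ∧ ∀ i ∈ c.2.2, i < k ∧ ∃ L ∈ links,
    [c.1, k, c.2.1, i].Sublist L ∨ [k, c.2.1, i, c.1].Sublist L ∨
      [c.2.1, i, c.1, k].Sublist L ∨ [i, c.1, k, c.2.1].Sublist L

instance (st : Step) (k : ℕ) : Decidable (st.Valid k) := by
  unfold Step.Valid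
  infer_instance

theorem steps_valid : ∀ q ∈ steps.zipIdx, q.1.Valid q.2 := by decide +kernel

/-- A coherently orientable set of faces whose boundary has at most two edges at every vertex
does not have Euler characteristic `-1`. -/
theorem euler_ne_of_isCoherent {B C : Finset (Finset ℕ)} (hB : B ⊆ faceSet)
    {σ : Finset ℕ → ℕ × ℕ × ℕ} (hσ : IsCoherent B σ)
    (hC : ∀ v, (C.filter (fun e => v ∈ e)).card ≤ 2)
    (hbd : ∀ f ∈ faceSet, ∀ g ∈ faceSet, (f ∩ g).card = 2 → f ∈ B → g ∉ B → f ∩ g ∈ C) :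
    ((vertsOf B).card : ℤ) - (edgesOf B).card + B.card ≠ -1 := by
  obtain ⟨i₀, hi₀⟩ : ∃ i₀, ∀ k, face k ∈ B → face i₀ ∈ B ∧ i₀ ≤ k := by
    by_cases h : ∃ k, face k ∈ B
    · exact ⟨Nat.find h, fun k hk => ⟨Nat.find_spec h, Nat.find_min' h hk⟩⟩
    · exact ⟨0, fun k hk => absurd ⟨k, hk⟩ h⟩
  have hholds : ∀ (j : ℕ) (st : Step), steps[j]? = some st → st.Holds (fun i => decide (face i ∈ B))
      (fun i => sign σ i == sign σ i₀) (0 + j) := by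
    intro j st hj
    rw [Nat.zero_add]
    obtain ⟨hj24, hface, hagree, hdisagree, hcorners⟩ :=
      steps_valid (st, j) (List.mk_mem_zipIdx_iff_getElem?.2 hj)
    refine ⟨hface, fun i hi => (hagree i hi).1, fun i hi => (hdisagree i hi).1,
      fun c hc => ⟨(hcorners c hc).1, (hcorners c hc).2.1,
        fun i hi => ((hcorners c hc).2.2 i hi).1⟩, ?_, ?_, ?_, ?_⟩
    · intro i hi hjB hiB
      obtain ⟨hij, hne, e, he₁, he₂⟩ := hagree i hi
      simp only [decide_eq_true_eq] at hjB hiB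
      simp only [sign_eq hσ (hij.trans hj24) hj24 hiB hjB hne he₁ he₂]
    · intro i hi hjB hiB
      obtain ⟨hij, hne, e, he₁, he₂⟩ := hdisagree i hi
      simp only [decide_eq_true_eq] at hjB hiB
      simp only [sign_ne hσ (hij.trans hj24) hj24 hiB hjB hne he₁ he₂]
      cases sign σ j <;> cases sign σ i₀ <;> rfl
    · intro c hc h₁ h₂ i hi h₃
      obtain ⟨-, L, hL, h⟩ := (hcorners c hc).2.2 i hi
      have h₄ := h₃ ▸ h₁
      have h₅ := h₃ ▸ h₂
      rcases h with h | h | h | h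
      · exact not_alternating hC hbd hL h h₁ h₂.symm h₅
      · exact not_alternating hC hbd hL h h₂.symm h₅ h₄.symm
      · exact not_alternating hC hbd hL h h₅ h₄.symm h₁
      · exact not_alternating hC hbd hL h h₄.symm h₁ h₂.symm
    · intro hjB hp
      simp only [decide_eq_true_eq] at hjB
      obtain ⟨h₁, h₂⟩ := hi₀ j hjB
      refine ⟨i₀, lt_of_le_of_ne h₂ ?_, by simpa using h₁, by simp⟩
      rintro rfl
      simp at hp
  have hzero : ∀ b : ℕ → Bool, Represents 0 b 0 := fun b i => by simp
  obtain ⟨n, hn, hleaf⟩ := exists_leafOK_of_search steps hholds (hzero _) (hzero _) (hzero _)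
    search_steps
  exact euler_ne_of_leafOK hB hn hleaf

theorem card_filter_mem_cycEdges_le {c : List ℕ} (hc : c.Nodup) (v : ℕ) :
    ((cycEdges c).filter (fun e => v ∈ e)).card ≤ 2 := by
  set n := c.length
  set k := c.idxOf v
  have hsub : (cycEdges c).filter (fun e => v ∈ e) ⊆
      ({k, (k + n - 1) % n} : Finset ℕ).image
        (fun i => ({c.getD i 0, c.getD ((i + 1) % n) 0} : Finset ℕ)) := by
    intro e he
    obtain ⟨he, hv⟩ := Finset.mem_filter.1 he
    obtain ⟨i, hi, rfl⟩ := Finset.mem_image.1 he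
    refine Finset.mem_image_of_mem _ ?_
    have hin : i < n := Finset.mem_range.1 hi
    have hidx : ∀ j < n, v = c.getD j 0 → k = j := by
      intro j hj hv
      change c.idxOf v = j
      rw [hv, List.getD_eq_getElem _ _ hj]
      exact hc.idxOf_getElem j hj
    simp only [Finset.mem_insert, Finset.mem_singleton] at hv ⊢
    rcases hv with hv | hv
    · exact Or.inl (hidx i hin hv).symm
    · right
      rw [hidx _ (Nat.mod_lt _ (by omega)) hv]
      rcases Nat.lt_or_ge (i + 1) n with h | h
      · rw [Nat.mod_eq_of_lt h, show i + 1 + n - 1 = i + n by omega, Nat.add_mod_right,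
          Nat.mod_eq_of_lt hin]
      · have h' : i + 1 = n := by omega
        rw [h', Nat.mod_self, Nat.zero_add, Nat.mod_eq_of_lt (by omega)]
        omega
  exact (Finset.card_le_card hsub).trans (Finset.card_image_le.trans Finset.card_le_two)

theorem euler_triangulation : triangulation.euler = -1 := by
  have hV : (vertsOf faceSet).card = 11 := by decide +kernel
  have hE : (edgesOf faceSet).card = 36 := by decide +kernel
  have hF : faceSet.card = 24 := by decide +kernel
  change ((vertsOf faceSet).card : ℤ) - (edgesOf faceSet).card + faceSet.card = -1
  rw [hV, hE, hF]
  norm_num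

theorem not_orientable_triangulation : ¬ triangulation.Orientable := fun ⟨_, hσ⟩ =>
  euler_ne_of_isCoherent (C := ∅) subset_rfl hσ (by simp) (fun _ _ _ hg _ _ hg' => absurd hg hg')
    euler_triangulation

end N3

/-- There is a triangulation of `N_3` with no NSC separating the surface into the
projective plane `N_1` (capped Euler characteristic 1, nonorientable) and the torus
`S_1` (capped Euler characteristic 0, orientable). -/
theorem exists_triangulation_n3_no_NSC_into_n1_s1 :
    ∃ T : Triangulation, T.IsN 3 ∧
      ∀ c : List ℕ, T.IsCycle c →
        ¬ ∃ f ∈ T.faces, ∃ g ∈ T.faces, ¬ T.SameSide c f g ∧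
          (T.sideEuler c f = 1 ∧ ¬ T.SideOrientable c f) ∧
          (T.sideEuler c g = 0 ∧ T.SideOrientable c g) := by
  refine ⟨N3.triangulation, ⟨by rw [N3.euler_triangulation]; norm_num,
    N3.not_orientable_triangulation⟩, ?_⟩
  rintro c ⟨-, hc, -⟩ ⟨-, -, g, -, -, -, heuler, σ, hσ⟩
  refine N3.euler_ne_of_isCoherent (B := N3.triangulation.sideFaces c g)
    (Finset.filter_subset _ _) hσ
    (N3.card_filter_mem_cycEdges_le hc) ?_ (by
      unfold Triangulation.sideEuler at heuler
      linarith)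
  intro f hf f' hf' hcard hfB hfB'
  by_contra hmem
  exact hfB' (Finset.mem_filter.2
    ⟨hf', (Finset.mem_filter.1 hfB).2.tail ⟨hf, hf', hcard, hmem⟩⟩)
end

section
/- For every integer g ≥ 1 there exists an irreducible triangulation of the nonorientable surface N_g with at least ⌊11g/2⌋ vertices; hence V_max(N_g) ≥ ⌊11g/2⌋, where V_max(S) denotes the maximum number of vertices in an irreducible triangulation of S. -/
open scoped Classical

namespace Triangulation

/-- Two faces of `F` are adjacent if they share an edge. -/
def FaceAdj (F : Finset (Finset ℕ)) (f g : Finset ℕ) : Prop :=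
  f ∈ F ∧ g ∈ F ∧ (f ∩ g).card = 2

/-- Any two faces of `F` are joined by a chain of adjacent faces of `F`. -/
def FaceConnected (F : Finset (Finset ℕ)) : Prop :=
  ∀ f ∈ F, ∀ g ∈ F, Relation.ReflTransGen (FaceAdj F) f g

theorem FaceAdj.symm {F : Finset (Finset ℕ)} {f g : Finset ℕ} (h : FaceAdj F f g) :
    FaceAdj F g f :=
  ⟨h.2.1, h.1, by rw [Finset.inter_comm]; exact h.2.2⟩

theorem reflTransGen_faceAdj_symm {F : Finset (Finset ℕ)} {f g : Finset ℕ}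
    (h : Relation.ReflTransGen (FaceAdj F) f g) : Relation.ReflTransGen (FaceAdj F) g f := by
  induction h with
  | refl => exact .refl
  | tail _ hbc ih => exact ih.head hbc.symm

theorem FaceAdj.mono {F G : Finset (Finset ℕ)} (hFG : F ⊆ G) {f g : Finset ℕ}
    (h : FaceAdj F f g) : FaceAdj G f g :=
  ⟨hFG h.1, hFG h.2.1, h.2.2⟩

theorem reflTransGen_faceAdj_mono {F G : Finset (Finset ℕ)} (hFG : F ⊆ G) {f g : Finset ℕ}
    (h : Relation.ReflTransGen (FaceAdj F) f g) : Relation.ReflTransGen (FaceAdj G) f g := by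
  induction h with
  | refl => exact .refl
  | tail _ hbc ih => exact ih.tail (hbc.mono hFG)

theorem faceConnected_faces (T : Triangulation) : FaceConnected T.faces :=
  T.face_connected

theorem faceConnected_star_iff {F : Finset (Finset ℕ)} {v : ℕ} :
    FaceConnected (F.filter (v ∈ ·)) ↔
      ∀ f ∈ F, ∀ g ∈ F, v ∈ f → v ∈ g → Relation.ReflTransGen
        (fun f' g' => f' ∈ F ∧ g' ∈ F ∧ v ∈ f' ∧ v ∈ g' ∧ (f' ∩ g').card = 2) f g := by
  have key : FaceAdj (F.filter (v ∈ ·)) =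
      fun f' g' => f' ∈ F ∧ g' ∈ F ∧ v ∈ f' ∧ v ∈ g' ∧ (f' ∩ g').card = 2 := by
    funext f g
    simp only [FaceAdj, Finset.mem_filter, eq_iff_iff]
    tauto
  rw [FaceConnected, key]
  simp only [Finset.mem_filter]
  exact ⟨fun h f hf g hg hvf hvg => h f ⟨hf, hvf⟩ g ⟨hg, hvg⟩,
    fun h f hf g hg => h f hf.1 g hg.1 hf.2 hg.2⟩

theorem faceConnected_star (T : Triangulation) (v : ℕ) :
    FaceConnected (T.faces.filter (v ∈ ·)) :=
  faceConnected_star_iff.2 (T.link_connected v)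

theorem faceConnected_of_isChain {F : Finset (Finset ℕ)} (l : List (Finset ℕ))
    (hl : l.IsChain (fun f g => (f ∩ g).card = 2)) (h : ∀ f, f ∈ l ↔ f ∈ F) :
    FaceConnected F := by
  have h1 : l.IsChain (Relation.ReflTransGen (FaceAdj F)) := by
    refine List.IsChain.imp_of_mem_imp (fun a b ha hb hab => ?_) hl
    exact Relation.ReflTransGen.single ⟨(h a).1 ha, (h b).1 hb, hab⟩
  have h2 := List.isChain_iff_pairwise.1 h1
  have : Std.Symm (Relation.ReflTransGen (FaceAdj F)) := ⟨fun _ _ => reflTransGen_faceAdj_symm⟩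
  intro f hf g hg
  exact h2.forall_of_forall (fun _ _ => .refl) ((h f).2 hf) ((h g).2 hg)

/-- If removing `D` from `B` leaves a connected set, and every neighbour of `D` in `A` has a
neighbour in `B` other than `D`, then `A` and `B` remain connected after being joined along
the removed face `D`. -/
theorem FaceConnected.erase_union_erase {A B : Finset (Finset ℕ)} {D : Finset ℕ}
    (hA : FaceConnected A) (hB : FaceConnected (B.erase D)) (hD : D ∈ A)
    (hcross : ∀ f ∈ A.erase D, (f ∩ D).card = 2 → ∃ g ∈ B.erase D, (f ∩ g).card = 2) :
    FaceConnected (A.erase D ∪ B.erase D) := by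
  have hBU : B.erase D ⊆ A.erase D ∪ B.erase D := Finset.subset_union_right
  have toB : ∀ f ∈ A.erase D ∪ B.erase D, ∃ g ∈ B.erase D,
      Relation.ReflTransGen (FaceAdj (A.erase D ∪ B.erase D)) f g := by
    intro f hf
    rcases Finset.mem_union.1 hf with hf | hf
    · have hpath := hA f (Finset.mem_of_mem_erase hf) D hD
      have hne := Finset.ne_of_mem_erase hf
      clear hf
      induction hpath using Relation.ReflTransGen.head_induction_on with
      | refl => exact absurd rfl hne
      | head hab _ ih =>
        rename_i a b _
        have ha : a ∈ A.erase D := Finset.mem_erase.2 ⟨hne, hab.1⟩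
        by_cases hb : b = D
        · subst hb
          obtain ⟨g, hg, hag⟩ := hcross a ha hab.2.2
          exact ⟨g, hg, .single ⟨Finset.mem_union_left _ ha, hBU hg, hag⟩⟩
        · obtain ⟨g, hg, hbg⟩ := ih (Finset.mem_union_left _ (Finset.mem_erase.2 ⟨hb, hab.2.1⟩)) hb
          exact ⟨g, hg, .head ⟨Finset.mem_union_left _ ha,
            Finset.mem_union_left _ (Finset.mem_erase.2 ⟨hb, hab.2.1⟩), hab.2.2⟩ hbg⟩
    · exact ⟨f, hf, .refl⟩
  intro f hf g hg
  obtain ⟨f', hf', hff'⟩ := toB f hf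
  obtain ⟨g', hg', hgg'⟩ := toB g hg
  exact hff'.trans ((reflTransGen_faceAdj_mono hBU (hB f' hf' g' hg')).trans
    (reflTransGen_faceAdj_symm hgg'))

theorem mem_vertsOf {F : Finset (Finset ℕ)} {v : ℕ} : v ∈ vertsOf F ↔ ∃ f ∈ F, v ∈ f := by
  simp [vertsOf, Finset.mem_sup]

theorem subset_vertsOf {F : Finset (Finset ℕ)} {f : Finset ℕ} (hf : f ∈ F) : f ⊆ vertsOf F :=
  fun _ hv => mem_vertsOf.2 ⟨f, hf, hv⟩

theorem mem_edgesOf {F : Finset (Finset ℕ)} {e : Finset ℕ} :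
    e ∈ edgesOf F ↔ e.card = 2 ∧ ∃ f ∈ F, e ⊆ f := by
  simp only [edgesOf, Finset.mem_filter, Finset.mem_powersetCard]
  exact ⟨fun h => ⟨h.1.2, h.2⟩,
    fun ⟨h, f, hf, hef⟩ => ⟨⟨hef.trans (subset_vertsOf hf), h⟩, f, hf, hef⟩⟩

theorem two_mul_card_edges (T : Triangulation) : T.edges.card * 2 = T.faces.card * 3 := by
  refine Finset.card_mul_eq_card_mul (fun e f => e ⊆ f) (fun e he => ?_) (fun f hf => ?_)
  · obtain ⟨hc, hf⟩ := mem_edgesOf.1 he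
    exact T.edge_in_two_faces e hc hf
  · have : Finset.bipartiteBelow (fun e f : Finset ℕ => e ⊆ f) T.edges f =
        Finset.powersetCard 2 f := by
      ext e
      simp only [Finset.bipartiteBelow, Finset.mem_filter, Finset.mem_powersetCard, edges,
        mem_edgesOf]
      exact ⟨fun h => ⟨h.2, h.1.1⟩, fun h => ⟨⟨h.2, f, hf, h.1⟩, h.1⟩⟩
    rw [this, Finset.card_powersetCard, T.card_eq_three f hf]
    rfl

theorem euler_eq_of_card {T : Triangulation} {n g : ℕ} (hn : T.verts.card = n)
    (hF : T.faces.card + 4 = 2 * n + 2 * g) : T.euler = 2 - (g : ℤ) := by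
  have := T.two_mul_card_edges
  unfold euler
  omega

theorem exists_face_ne {T : Triangulation} {D e : Finset ℕ} (hD : D ∈ T.faces) (heD : e ⊆ D)
    (he : e.card = 2) : ∃ f ∈ T.faces.erase D, e ⊆ f := by
  have h2 := T.edge_in_two_faces e he ⟨D, hD, heD⟩
  obtain ⟨f, hf, hne⟩ := Finset.exists_mem_ne (show 1 < (T.faces.filter (fun f => e ⊆ f)).card by omega) D
  rw [Finset.mem_filter] at hf
  exact ⟨f, Finset.mem_erase.2 ⟨hne, hf.1⟩, hf.2⟩

theorem exists_edge_of_mem {f : Finset ℕ} (hf : f.card = 3) {v : ℕ} (hv : v ∈ f) :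
    ∃ e ⊆ f, v ∈ e ∧ e.card = 2 := by
  obtain ⟨e, h1, h2, h3⟩ := Finset.exists_subsuperset_card_eq (n := 2)
    (Finset.singleton_subset_iff.2 hv) (by simp) (by omega)
  exact ⟨e, h2, Finset.singleton_subset_iff.1 h1, h3⟩

/-- The edge `e` lies in a 3-cycle of the graph which is not a face. -/
def InNonfacialTriangle (F : Finset (Finset ℕ)) (e : Finset ℕ) : Prop :=
  ∃ t : Finset ℕ, t.card = 3 ∧ e ⊆ t ∧ t ∉ F ∧ ∀ d ⊆ t, d.card = 2 → ∃ f ∈ F, d ⊆ f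

theorem irreducible_of_inNonfacialTriangle {T : Triangulation}
    (h : ∀ f ∈ T.faces, ∀ e ⊆ f, e.card = 2 → InNonfacialTriangle T.faces e) :
    T.Irreducible := by
  rintro e ⟨he, hcard⟩
  obtain ⟨hc, f, hf, hef⟩ := mem_edgesOf.1 he
  obtain ⟨t, ht, het, htF, hd⟩ := h f hf e hef hc
  have h2 := T.edge_in_two_faces e hc ⟨f, hf, hef⟩
  have hsub : insert t (T.faces.filter (fun f => e ⊆ f)) ⊆
      T.triangles.filter (fun t => e ⊆ t) := by
    intro s hs
    simp only [Finset.mem_insert, Finset.mem_filter] at hs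
    simp only [triangles, Finset.mem_filter, Finset.mem_powersetCard, edges, mem_edgesOf]
    rcases hs with rfl | ⟨hs, hes⟩
    · refine ⟨⟨⟨fun v hv => ?_, ht⟩, fun d hds => ⟨hds.2, hd d hds.1 hds.2⟩⟩, het⟩
      obtain ⟨d, hdt, hvd, hd2⟩ := exists_edge_of_mem ht hv
      obtain ⟨f, hf, hdf⟩ := hd d hdt hd2
      exact mem_vertsOf.2 ⟨f, hf, hdf hvd⟩
    · exact ⟨⟨⟨subset_vertsOf hs, T.card_eq_three s hs⟩, fun d hds => ⟨hds.2, s, hs, hds.1⟩⟩, hes⟩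
  have := Finset.card_le_card hsub
  rw [Finset.card_insert_of_notMem (by simp [htF])] at this
  omega

/-- `T₁` and `T₂` meet only in their common face `D`, and removing `D` disconnects neither the
faces of `T₂` nor the stars in `T₂` of the vertices of `D`. -/
structure Gluable (T₁ T₂ : Triangulation) (D : Finset ℕ) : Prop where
  left_mem : D ∈ T₁.faces
  right_mem : D ∈ T₂.faces
  inter_subset : ∀ v ∈ T₁.verts, v ∈ T₂.verts → v ∈ D
  faceConnected : FaceConnected (T₂.faces.erase D)
  faceConnected_star : ∀ v ∈ D, FaceConnected ((T₂.faces.erase D).filter (v ∈ ·))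

namespace Gluable

variable {T₁ T₂ : Triangulation} {D : Finset ℕ}

theorem inter_subset_of_mem (h : Gluable T₁ T₂ D) {f g : Finset ℕ} (hf : f ∈ T₁.faces) (hg : g ∈ T₂.faces) :
    f ∩ g ⊆ D := by
  intro v hv
  rw [Finset.mem_inter] at hv
  exact h.inter_subset v (subset_vertsOf hf hv.1) (subset_vertsOf hg hv.2)

theorem eq_of_mem (h : Gluable T₁ T₂ D) {f : Finset ℕ} (hf : f ∈ T₁.faces) (hf' : f ∈ T₂.faces) : f = D := by
  have := h.inter_subset_of_mem hf hf'
  rw [Finset.inter_self] at this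
  exact Finset.eq_of_subset_of_card_le this
    (by rw [T₁.card_eq_three f hf, T₁.card_eq_three D h.left_mem])

theorem exists_crossing (h : Gluable T₁ T₂ D) {f : Finset ℕ} (hf : f ∈ T₁.faces.erase D) (hc : (f ∩ D).card = 2) :
    ∃ g ∈ T₂.faces.erase D, f ∩ D ⊆ g ∧ (f ∩ g).card = 2 := by
  obtain ⟨g, hg, hsub⟩ := exists_face_ne h.right_mem Finset.inter_subset_right hc
  refine ⟨g, hg, hsub, ?_⟩
  have : f ∩ g = f ∩ D := by
    refine (Finset.subset_inter Finset.inter_subset_left ?_).antisymm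
      (Finset.subset_inter Finset.inter_subset_left hsub)
    exact h.inter_subset_of_mem (Finset.mem_of_mem_erase hf) (Finset.mem_of_mem_erase hg)
  rw [this, hc]

theorem disjoint_erase (h : Gluable T₁ T₂ D) : Disjoint (T₁.faces.erase D) (T₂.faces.erase D) := by
  rw [Finset.disjoint_left]
  intro f hf hf'
  exact Finset.ne_of_mem_erase hf
    (h.eq_of_mem (Finset.mem_of_mem_erase hf) (Finset.mem_of_mem_erase hf'))

theorem card_filter_subset (h : Gluable T₁ T₂ D) {e : Finset ℕ} (he : e.card = 2)
    (hex : ∃ f ∈ T₁.faces.erase D ∪ T₂.faces.erase D, e ⊆ f) :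
    ((T₁.faces.erase D ∪ T₂.faces.erase D).filter (fun f => e ⊆ f)).card = 2 := by
  rw [Finset.filter_union, Finset.card_union_of_disjoint
    (Finset.disjoint_filter_filter h.disjoint_erase)]
  by_cases heD : e ⊆ D
  · have key : ∀ T : Triangulation, D ∈ T.faces →
        ((T.faces.erase D).filter (fun f => e ⊆ f)).card = 1 := by
      intro T hT
      rw [Finset.filter_erase, Finset.card_erase_of_mem (by simp [hT, heD]),
        T.edge_in_two_faces e he ⟨D, hT, heD⟩]
    rw [key T₁ h.left_mem, key T₂ h.right_mem]
  · have key : ∀ T : Triangulation, (∃ f ∈ T.faces, e ⊆ f) →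
        ((T.faces.erase D).filter (fun f => e ⊆ f)).card = 2 := by
      intro T hT
      rw [Finset.filter_erase, Finset.erase_eq_of_notMem (by simp [heD]),
        T.edge_in_two_faces e he hT]
    have key0 : ∀ T : Triangulation, (∀ f ∈ T.faces, ¬ e ⊆ f) →
        ((T.faces.erase D).filter (fun f => e ⊆ f)).card = 0 := by
      intro T hT
      rw [Finset.card_eq_zero, Finset.filter_eq_empty_iff]
      exact fun f hf => hT f (Finset.mem_of_mem_erase hf)
    have excl : ∀ f ∈ T₁.faces, ∀ g ∈ T₂.faces, e ⊆ f → e ⊆ g → False :=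
      fun f hf g hg hef heg =>
        heD ((Finset.subset_inter hef heg).trans (h.inter_subset_of_mem hf hg))
    obtain ⟨f, hf, hef⟩ := hex
    rcases Finset.mem_union.1 hf with hf | hf
    · have hf := Finset.mem_of_mem_erase hf
      rw [key T₁ ⟨f, hf, hef⟩, key0 T₂ (fun g hg heg => excl f hf g hg hef heg)]
    · have hf := Finset.mem_of_mem_erase hf
      rw [key T₂ ⟨f, hf, hef⟩, key0 T₁ (fun g hg heg => excl g hg f hf heg hef)]

theorem faceConnected_union (h : Gluable T₁ T₂ D) : FaceConnected (T₁.faces.erase D ∪ T₂.faces.erase D) :=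
  T₁.faceConnected_faces.erase_union_erase h.faceConnected h.left_mem fun _ hf hc =>
    let ⟨g, hg, _, hfg⟩ := h.exists_crossing hf hc
    ⟨g, hg, hfg⟩

theorem faceConnected_star_union (h : Gluable T₁ T₂ D) (v : ℕ) :
    FaceConnected ((T₁.faces.erase D ∪ T₂.faces.erase D).filter (v ∈ ·)) := by
  rw [Finset.filter_union]
  by_cases hv : v ∈ D
  · have h2 := h.faceConnected_star v hv
    rw [Finset.filter_erase] at h2 ⊢
    rw [Finset.filter_erase]
    refine (T₁.faceConnected_star v).erase_union_erase h2 (by simp [h.left_mem, hv]) ?_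
    intro f hf hc
    rw [← Finset.filter_erase, Finset.mem_filter] at hf
    obtain ⟨g, hg, hsub, hfg⟩ := h.exists_crossing hf.1 hc
    refine ⟨g, ?_, hfg⟩
    rw [← Finset.filter_erase, Finset.mem_filter]
    exact ⟨hg, hsub (Finset.mem_inter.2 ⟨hf.2, hv⟩)⟩
  · have key : ∀ T : Triangulation,
        (T.faces.erase D).filter (v ∈ ·) = T.faces.filter (v ∈ ·) := by
      intro T
      rw [Finset.filter_erase, Finset.erase_eq_of_notMem (by simp [hv])]
    rw [key, key]
    have key0 : ∀ T : Triangulation, v ∉ T.verts → T.faces.filter (v ∈ ·) = ∅ := by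
      intro T hT
      rw [Finset.filter_eq_empty_iff]
      exact fun f hf hvf => hT (subset_vertsOf hf hvf)
    by_cases h1 : v ∈ T₁.verts
    · rw [key0 T₂ (fun h2 => hv (h.inter_subset v h1 h2)), Finset.union_empty]
      exact T₁.faceConnected_star v
    · rw [key0 T₁ h1, Finset.empty_union]
      exact T₂.faceConnected_star v

/-- The connected sum of `T₁` and `T₂` along the common face `D`. -/
noncomputable def glue (h : Gluable T₁ T₂ D) : Triangulation where
  faces := T₁.faces.erase D ∪ T₂.faces.erase D
  faces_nonempty := by
    obtain ⟨e, heD, he⟩ := Finset.exists_subset_card_eq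
      (show 2 ≤ D.card by rw [T₁.card_eq_three D h.left_mem]; omega)
    obtain ⟨f, hf, -⟩ := exists_face_ne h.left_mem heD he
    exact ⟨f, Finset.mem_union_left _ hf⟩
  card_eq_three f hf := by
    rcases Finset.mem_union.1 hf with hf | hf
    · exact T₁.card_eq_three f (Finset.mem_of_mem_erase hf)
    · exact T₂.card_eq_three f (Finset.mem_of_mem_erase hf)
  edge_in_two_faces _ he hex := h.card_filter_subset he hex
  link_connected v := faceConnected_star_iff.1 (h.faceConnected_star_union v)
  face_connected := h.faceConnected_union

theorem glue_faces (h : Gluable T₁ T₂ D) : h.glue.faces = T₁.faces.erase D ∪ T₂.faces.erase D := rfl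

theorem card_glue_faces (h : Gluable T₁ T₂ D) : h.glue.faces.card + 2 = T₁.faces.card + T₂.faces.card := by
  rw [glue_faces, Finset.card_union_of_disjoint h.disjoint_erase,
    Finset.card_erase_of_mem h.left_mem, Finset.card_erase_of_mem h.right_mem]
  have := Finset.card_pos.2 ⟨D, h.left_mem⟩
  have := Finset.card_pos.2 ⟨D, h.right_mem⟩
  omega

theorem glue_verts (h : Gluable T₁ T₂ D) : h.glue.verts = T₁.verts ∪ T₂.verts := by
  have key : ∀ T : Triangulation, D ∈ T.faces → vertsOf (T.faces.erase D) = T.verts := by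
    intro T hT
    ext v
    simp only [verts, mem_vertsOf]
    constructor
    · rintro ⟨f, hf, hvf⟩
      exact ⟨f, Finset.mem_of_mem_erase hf, hvf⟩
    · rintro ⟨f, hf, hvf⟩
      by_cases hfD : f = D
      · subst hfD
        obtain ⟨e, hef, hve, he⟩ := exists_edge_of_mem (T.card_eq_three f hf) hvf
        obtain ⟨g, hg, heg⟩ := exists_face_ne hf hef he
        exact ⟨g, hg, heg hve⟩
      · exact ⟨f, Finset.mem_erase.2 ⟨hfD, hf⟩, hvf⟩
  rw [← key T₁ h.left_mem, ← key T₂ h.right_mem, verts, glue_faces, vertsOf, Finset.sup_union]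
  rfl

theorem card_glue_verts (h : Gluable T₁ T₂ D) : h.glue.verts.card + 3 = T₁.verts.card + T₂.verts.card := by
  have hD : T₁.verts ∩ T₂.verts = D := by
    refine Finset.Subset.antisymm (fun v hv => ?_)
      (Finset.subset_inter (subset_vertsOf h.left_mem) (subset_vertsOf h.right_mem))
    rw [Finset.mem_inter] at hv
    exact h.inter_subset v hv.1 hv.2
  have := Finset.card_union_add_card_inter T₁.verts T₂.verts
  rw [hD, T₁.card_eq_three D h.left_mem] at this
  rw [h.glue_verts, this]

theorem exists_glue_face (h : Gluable T₁ T₂ D) {d f : Finset ℕ} (hd : d.card = 2) (hf : f ∈ T₁.faces ∨ f ∈ T₂.faces)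
    (hdf : d ⊆ f) : ∃ g ∈ h.glue.faces, d ⊆ g := by
  by_cases hfD : f = D
  · subst hfD
    obtain ⟨g, hg, hdg⟩ := exists_face_ne h.left_mem hdf hd
    exact ⟨g, Finset.mem_union_left _ hg, hdg⟩
  · refine ⟨f, ?_, hdf⟩
    rw [glue_faces, Finset.mem_union, Finset.mem_erase, Finset.mem_erase]
    tauto

theorem notMem_glue_faces (h : Gluable T₁ T₂ D) : D ∉ h.glue.faces := by
  simp [glue_faces]

theorem inNonfacialTriangle_of_subset (h : Gluable T₁ T₂ D) {e : Finset ℕ} (he : e ⊆ D) :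
    InNonfacialTriangle h.glue.faces e :=
  ⟨D, T₁.card_eq_three D h.left_mem, he, h.notMem_glue_faces,
    fun _ hd hd2 => h.exists_glue_face hd2 (.inl h.left_mem) hd⟩

theorem inNonfacialTriangle_left (h : Gluable T₁ T₂ D) {e : Finset ℕ} (he : InNonfacialTriangle T₁.faces e) :
    InNonfacialTriangle h.glue.faces e := by
  obtain ⟨t, ht, het, htF, hd⟩ := he
  refine ⟨t, ht, het, fun hmem => ?_, fun d hdt hd2 => ?_⟩
  · rw [glue_faces, Finset.mem_union] at hmem
    rcases hmem with hmem | hmem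
    · exact htF (Finset.mem_of_mem_erase hmem)
    · have htD : t ⊆ D := by
        intro v hv
        obtain ⟨d, hdt, hvd, hd2⟩ := exists_edge_of_mem ht hv
        obtain ⟨f, hf, hdf⟩ := hd d hdt hd2
        exact h.inter_subset v (subset_vertsOf hf (hdf hvd))
          (subset_vertsOf (Finset.mem_of_mem_erase hmem) hv)
      exact Finset.ne_of_mem_erase hmem (Finset.eq_of_subset_of_card_le htD
        (by rw [ht, T₁.card_eq_three D h.left_mem]))
  · obtain ⟨f, hf, hdf⟩ := hd d hdt hd2
    exact h.exists_glue_face hd2 (.inl hf) hdf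

theorem inNonfacialTriangle_right (h : Gluable T₁ T₂ D) {e : Finset ℕ} (he : InNonfacialTriangle T₂.faces e) :
    InNonfacialTriangle h.glue.faces e := by
  obtain ⟨t, ht, het, htF, hd⟩ := he
  refine ⟨t, ht, het, fun hmem => ?_, fun d hdt hd2 => ?_⟩
  · rw [glue_faces, Finset.mem_union] at hmem
    rcases hmem with hmem | hmem
    · have htD : t ⊆ D := by
        intro v hv
        obtain ⟨d, hdt, hvd, hd2⟩ := exists_edge_of_mem ht hv
        obtain ⟨f, hf, hdf⟩ := hd d hdt hd2
        exact h.inter_subset v (subset_vertsOf (Finset.mem_of_mem_erase hmem) hv)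
          (subset_vertsOf hf (hdf hvd))
      exact Finset.ne_of_mem_erase hmem (Finset.eq_of_subset_of_card_le htD
        (by rw [ht, T₁.card_eq_three D h.left_mem]))
    · exact htF (Finset.mem_of_mem_erase hmem)
  · obtain ⟨f, hf, hdf⟩ := hd d hdt hd2
    exact h.exists_glue_face hd2 (.inr hf) hdf

end Gluable

/-- The faces of `F` with their vertices relabelled by `φ`. -/
def mapFaces (φ : ℕ ↪ ℕ) (F : Finset (Finset ℕ)) : Finset (Finset ℕ) :=
  F.map (Finset.mapEmbedding φ).toEmbedding

theorem mem_mapFaces {φ : ℕ ↪ ℕ} {F : Finset (Finset ℕ)} {f : Finset ℕ} :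
    f ∈ mapFaces φ F ↔ ∃ g ∈ F, g.map φ = f := by
  simp [mapFaces]

theorem card_mapFaces (φ : ℕ ↪ ℕ) (F : Finset (Finset ℕ)) :
    (mapFaces φ F).card = F.card :=
  Finset.card_map _

theorem vertsOf_mapFaces (φ : ℕ ↪ ℕ) (F : Finset (Finset ℕ)) :
    vertsOf (mapFaces φ F) = (vertsOf F).map φ := by
  ext v
  simp only [mem_vertsOf, mem_mapFaces, Finset.mem_map]
  constructor
  · rintro ⟨_, ⟨g, hg, rfl⟩, hv⟩
    obtain ⟨w, hw, rfl⟩ := Finset.mem_map.1 hv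
    exact ⟨w, ⟨g, hg, hw⟩, rfl⟩
  · rintro ⟨w, ⟨g, hg, hw⟩, rfl⟩
    exact ⟨_, ⟨g, hg, rfl⟩, Finset.mem_map_of_mem φ hw⟩

theorem FaceConnected.mapFaces {F : Finset (Finset ℕ)} (h : FaceConnected F) (φ : ℕ ↪ ℕ) :
    FaceConnected (mapFaces φ F) := by
  intro f' hf' g' hg'
  obtain ⟨f, hf, rfl⟩ := mem_mapFaces.1 hf'
  obtain ⟨g, hg, rfl⟩ := mem_mapFaces.1 hg'
  refine Relation.ReflTransGen.lift (Finset.map φ) (fun a b hab => ?_) _ _ (h f hf g hg)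
  refine ⟨mem_mapFaces.2 ⟨a, hab.1, rfl⟩, mem_mapFaces.2 ⟨b, hab.2.1, rfl⟩, ?_⟩
  rw [← Finset.map_inter, Finset.card_map, hab.2.2]

theorem mapFaces_filter {φ : ℕ ↪ ℕ} {F : Finset (Finset ℕ)} {p q : Finset ℕ → Prop}
    [DecidablePred p] [DecidablePred q] (hpq : ∀ f, p (f.map φ) ↔ q f) :
    (mapFaces φ F).filter p = mapFaces φ (F.filter q) := by
  ext f
  simp only [Finset.mem_filter, mem_mapFaces]
  constructor
  · rintro ⟨⟨g, hg, rfl⟩, hp⟩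
    exact ⟨g, ⟨hg, (hpq g).1 hp⟩, rfl⟩
  · rintro ⟨g, ⟨hg, hq⟩, rfl⟩
    exact ⟨⟨g, hg, rfl⟩, (hpq g).2 hq⟩

/-- The triangulation `T` with its vertices relabelled by `φ`. -/
def relabel (φ : ℕ ↪ ℕ) (T : Triangulation) : Triangulation where
  faces := mapFaces φ T.faces
  faces_nonempty := T.faces_nonempty.map
  card_eq_three f hf := by
    obtain ⟨g, hg, rfl⟩ := mem_mapFaces.1 hf
    rw [Finset.card_map, T.card_eq_three g hg]
  edge_in_two_faces e he hex := by
    obtain ⟨f, hf, hef⟩ := hex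
    obtain ⟨g, hg, rfl⟩ := mem_mapFaces.1 hf
    obtain ⟨d, hd, rfl⟩ := Finset.subset_map_iff.1 hef
    rw [mapFaces_filter (q := fun f => d ⊆ f) (fun f => Finset.map_subset_map),
      card_mapFaces]
    exact T.edge_in_two_faces d (by rwa [Finset.card_map] at he) ⟨g, hg, hd⟩
  link_connected := by
    intro v f hf g hg hvf hvg
    obtain ⟨f', hf', rfl⟩ := mem_mapFaces.1 hf
    obtain ⟨w, hw, rfl⟩ := Finset.mem_map.1 hvf
    refine faceConnected_star_iff.1 ?_ _ hf _ hg hvf hvg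
    rw [mapFaces_filter (q := (w ∈ ·)) (fun f => Finset.mem_map' φ)]
    exact (T.faceConnected_star w).mapFaces φ
  face_connected := T.faceConnected_faces.mapFaces φ

theorem relabel_faces (φ : ℕ ↪ ℕ) (T : Triangulation) :
    (T.relabel φ).faces = mapFaces φ T.faces := rfl

theorem relabel_verts (φ : ℕ ↪ ℕ) (T : Triangulation) :
    (T.relabel φ).verts = T.verts.map φ :=
  vertsOf_mapFaces φ T.faces

theorem InNonfacialTriangle.mapFaces {F : Finset (Finset ℕ)} {e : Finset ℕ}
    (h : InNonfacialTriangle F e) (φ : ℕ ↪ ℕ) :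
    InNonfacialTriangle (mapFaces φ F) (e.map φ) := by
  obtain ⟨t, ht, het, htF, hd⟩ := h
  refine ⟨t.map φ, by rw [Finset.card_map, ht], Finset.map_subset_map.2 het, ?_, ?_⟩
  · rw [mem_mapFaces]
    rintro ⟨g, hg, hgt⟩
    exact htF (Finset.map_injective φ hgt ▸ hg)
  · intro d hdt hd2
    obtain ⟨c, hct, rfl⟩ := Finset.subset_map_iff.1 hdt
    obtain ⟨f, hf, hcf⟩ := hd c hct (by rwa [Finset.card_map] at hd2)
    exact ⟨f.map φ, mem_mapFaces.2 ⟨f, hf, rfl⟩, Finset.map_subset_map.2 hcf⟩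

theorem dedges_map (φ : ℕ ↪ ℕ) (t : ℕ × ℕ × ℕ) :
    (dedges t).map (φ.prodMap φ) = dedges (φ t.1, φ t.2.1, φ t.2.2) := by
  simp [dedges, Finset.map_insert, Prod.map]

theorem IsCoherent.mono {F G : Finset (Finset ℕ)} (hFG : F ⊆ G) {σ : Finset ℕ → ℕ × ℕ × ℕ}
    (h : IsCoherent G σ) : IsCoherent F σ :=
  ⟨fun f hf => h.1 f (hFG hf), fun f hf g hg => h.2 f (hFG hf) g (hFG hg)⟩

theorem exists_isCoherent_of_mapFaces {φ : ℕ ↪ ℕ} {F : Finset (Finset ℕ)}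
    (h : ∃ σ, IsCoherent (mapFaces φ F) σ) : ∃ σ, IsCoherent F σ := by
  obtain ⟨σ, h1, h2⟩ := h
  have key : ∀ f ∈ F, ∃ t : ℕ × ℕ × ℕ, σ (f.map φ) = (φ t.1, φ t.2.1, φ t.2.2) := by
    intro f hf
    have hs := h1 _ (mem_mapFaces.2 ⟨f, hf, rfl⟩)
    have hmem : ∀ x ∈ ({(σ (f.map φ)).1, (σ (f.map φ)).2.1, (σ (f.map φ)).2.2} : Finset ℕ),
        ∃ y, φ y = x := by
      intro x hx
      rw [hs, Finset.mem_map] at hx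
      exact ⟨hx.choose, hx.choose_spec.2⟩
    obtain ⟨a, ha⟩ := hmem (σ (f.map φ)).1 (by simp)
    obtain ⟨b, hb⟩ := hmem (σ (f.map φ)).2.1 (by simp)
    obtain ⟨c, hc⟩ := hmem (σ (f.map φ)).2.2 (by simp)
    exact ⟨(a, b, c), by rw [ha, hb, hc]⟩
  choose! τ hτ using key
  refine ⟨τ, fun f hf => ?_, fun f hf g hg hfg => ?_⟩
  · have hs := h1 _ (mem_mapFaces.2 ⟨f, hf, rfl⟩)
    rw [hτ f hf] at hs
    apply Finset.map_injective φ
    rw [← hs]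
    simp [Finset.map_insert]
  · have hd := h2 _ (mem_mapFaces.2 ⟨f, hf, rfl⟩) _ (mem_mapFaces.2 ⟨g, hg, rfl⟩)
      (fun h => hfg (Finset.map_injective φ h))
    rw [hτ f hf, hτ g hg, ← dedges_map, ← dedges_map, Finset.disjoint_map] at hd
    exact hd

/-- The embedding of `ℕ` fixing the numbers below `s` and adding `k` to all others. -/
def gap (s k : ℕ) : ℕ ↪ ℕ where
  toFun n := if n < s then n else n + k
  inj' a b h := by
    dsimp only at h
    split_ifs at h <;> omega

theorem gap_apply (s k n : ℕ) : gap s k n = if n < s then n else n + k := rfl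

/-- `T` has `n` vertices and Euler genus `g`, contains the face `{0, 1, 2}`, is nonorientable
away from this face, and only the edges of this face may be contractible. -/
structure IsMarked (g n : ℕ) (T : Triangulation) : Prop where
  mem_faces : {0, 1, 2} ∈ T.faces
  card_verts : T.verts.card = n
  card_faces : T.faces.card + 4 = 2 * n + 2 * g
  not_coherent : ¬ ∃ σ, IsCoherent (T.faces.erase {0, 1, 2}) σ
  inNonfacialTriangle : ∀ f ∈ T.faces, ∀ e ⊆ f, e.card = 2 →
    e ⊆ {0, 1, 2} ∨ InNonfacialTriangle T.faces e

/-- `P` has the vertices `0, …, k + 2` and Euler genus `g`, can be glued along the image of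
`{0, 1, 2}` under `gap s k`, and only the edges of this face and those in `E` may be
contractible. -/
structure IsPiece (s k g : ℕ) (E : Set (Finset ℕ)) (P : Triangulation) : Prop where
  le_three : s ≤ 3
  verts_eq : P.verts = Finset.range (k + 3)
  card_faces : P.faces.card + 4 = 2 * (k + 3) + 2 * g
  mem_faces : ({0, 1, 2} : Finset ℕ).map (gap s k) ∈ P.faces
  faceConnected : FaceConnected (P.faces.erase (({0, 1, 2} : Finset ℕ).map (gap s k)))
  faceConnected_star : ∀ v ∈ ({0, 1, 2} : Finset ℕ).map (gap s k), FaceConnected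
    ((P.faces.erase (({0, 1, 2} : Finset ℕ).map (gap s k))).filter (v ∈ ·))
  inNonfacialTriangle : ∀ f ∈ P.faces, ∀ e ⊆ f, e.card = 2 →
    e ⊆ ({0, 1, 2} : Finset ℕ).map (gap s k) ∨ e ∈ E ∨ InNonfacialTriangle P.faces e

section Extend

variable {g n s k g' : ℕ} {E : Set (Finset ℕ)} {T P : Triangulation}

theorem IsMarked.gluable (hT : IsMarked g n T) (hP : IsPiece s k g' E P) :
    Gluable (T.relabel (gap s k)) P (({0, 1, 2} : Finset ℕ).map (gap s k)) where
  left_mem := mem_mapFaces.2 ⟨_, hT.mem_faces, rfl⟩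
  right_mem := hP.mem_faces
  inter_subset v hv hv' := by
    rw [relabel_verts, Finset.mem_map] at hv
    obtain ⟨w, -, rfl⟩ := hv
    rw [hP.verts_eq, Finset.mem_range] at hv'
    refine Finset.mem_map_of_mem _ ?_
    have hs := hP.le_three
    rw [gap_apply] at hv'
    simp only [Finset.mem_insert, Finset.mem_singleton]
    split_ifs at hv' <;> omega
  faceConnected := hP.faceConnected
  faceConnected_star := hP.faceConnected_star

theorem IsMarked.card_verts_glue (hT : IsMarked g n T) (hP : IsPiece s k g' E P) :
    (hT.gluable hP).glue.verts.card = n + k := by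
  have h1 := (hT.gluable hP).card_glue_verts
  rw [relabel_verts, Finset.card_map, hT.card_verts, hP.verts_eq, Finset.card_range] at h1
  omega

theorem IsMarked.card_faces_glue (hT : IsMarked g n T) (hP : IsPiece s k g' E P) :
    (hT.gluable hP).glue.faces.card + 4 = 2 * (n + k) + 2 * (g + g') := by
  have h1 := (hT.gluable hP).card_glue_faces
  rw [relabel_faces, card_mapFaces] at h1
  have h2 := hT.card_faces
  have h3 := hP.card_faces
  omega

theorem IsMarked.not_coherent_of_subset (hT : IsMarked g n T) {φ : ℕ ↪ ℕ}
    {F : Finset (Finset ℕ)}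
    (hF : (T.relabel φ).faces.erase (({0, 1, 2} : Finset ℕ).map φ) ⊆ F) :
    ¬ ∃ σ, IsCoherent F σ := by
  rintro ⟨σ, hσ⟩
  refine hT.not_coherent (exists_isCoherent_of_mapFaces (φ := φ) ⟨σ, hσ.mono ?_⟩)
  refine Finset.Subset.trans ?_ hF
  intro f' hf'
  obtain ⟨f, hf, rfl⟩ := mem_mapFaces.1 hf'
  rw [Finset.mem_erase] at hf ⊢
  exact ⟨fun h => hf.1 (Finset.map_injective φ h), mem_mapFaces.2 ⟨f, hf.2, rfl⟩⟩

theorem IsMarked.inNonfacialTriangle_glue (hT : IsMarked g n T) (hP : IsPiece s k g' E P)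
    {f e : Finset ℕ} (hf : f ∈ (hT.gluable hP).glue.faces) (hef : e ⊆ f) (he : e.card = 2) :
    e ∈ E ∨ InNonfacialTriangle (hT.gluable hP).glue.faces e := by
  have hG := hT.gluable hP
  rcases Finset.mem_union.1 hf with hf | hf
  · obtain ⟨f', hf', rfl⟩ := mem_mapFaces.1 (Finset.mem_of_mem_erase hf)
    obtain ⟨d, hd, rfl⟩ := Finset.subset_map_iff.1 hef
    rw [Finset.card_map] at he
    refine .inr ?_
    rcases hT.inNonfacialTriangle f' hf' d hd he with h | h
    · exact hG.inNonfacialTriangle_of_subset (Finset.map_subset_map.2 h)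
    · exact hG.inNonfacialTriangle_left (h.mapFaces _)
  · rcases hP.inNonfacialTriangle f (Finset.mem_of_mem_erase hf) e hef he with h | h | h
    · exact .inr (hG.inNonfacialTriangle_of_subset h)
    · exact .inl h
    · exact .inr (hG.inNonfacialTriangle_right h)

theorem IsMarked.extend (hT : IsMarked g n T) (hP : IsPiece s k g' {e | e ⊆ {0, 1, 2}} P)
    (hmem : {0, 1, 2} ∈ P.faces) (hne : {0, 1, 2} ≠ ({0, 1, 2} : Finset ℕ).map (gap s k)) :
    ∃ T', IsMarked (g + g') (n + k) T' := by
  have hG := hT.gluable hP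
  refine ⟨hG.glue, ?_, hT.card_verts_glue hP, hT.card_faces_glue hP,
    hT.not_coherent_of_subset (φ := gap s k) ?_,
    fun f hf e hef he => hT.inNonfacialTriangle_glue hP hf hef he⟩
  · exact Finset.mem_union_right _ (Finset.mem_erase.2 ⟨hne, hmem⟩)
  · refine Finset.subset_erase.2 ⟨Finset.subset_union_left, fun h => ?_⟩
    exact Finset.ne_of_mem_erase h (hG.eq_of_mem (Finset.mem_of_mem_erase h) hmem)

theorem IsMarked.close (hT : IsMarked g n T) (hP : IsPiece s k g' ∅ P) :
    ∃ T' : Triangulation, T'.IsN (g + g') ∧ T'.Irreducible ∧ T'.verts.card = n + k := by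
  refine ⟨(hT.gluable hP).glue, ⟨?_, ?_⟩, ?_, hT.card_verts_glue hP⟩
  · exact euler_eq_of_card (hT.card_verts_glue hP) (hT.card_faces_glue hP)
  · exact hT.not_coherent_of_subset (φ := gap s k) Finset.subset_union_left
  · refine irreducible_of_inNonfacialTriangle fun f hf e hef he => ?_
    exact (hT.inNonfacialTriangle_glue hP hf hef he).resolve_left (Set.notMem_empty e)

end Extend

theorem mem_dedges_rotate {t : ℕ × ℕ × ℕ} {a b c : ℕ}
    (hs : ({t.1, t.2.1, t.2.2} : Finset ℕ) = {a, b, c}) (hab : a ≠ b) (hbc : b ≠ c)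
    (hac : a ≠ c) : (a, b) ∈ dedges t ↔ (b, c) ∈ dedges t := by
  obtain ⟨x, y, z⟩ := t
  simp only [dedges, Finset.mem_insert, Finset.mem_singleton, Prod.mk.injEq, Finset.ext_iff]
    at hs ⊢
  have ha := hs a
  have hb := hs b
  have hc := hs c
  grind

theorem mem_dedges_swap {t : ℕ × ℕ × ℕ} {a b c : ℕ}
    (hs : ({t.1, t.2.1, t.2.2} : Finset ℕ) = {a, b, c}) (hab : a ≠ b) (hbc : b ≠ c)
    (hac : a ≠ c) : (b, a) ∈ dedges t ↔ (a, b) ∉ dedges t := by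
  obtain ⟨x, y, z⟩ := t
  simp only [dedges, Finset.mem_insert, Finset.mem_singleton, Prod.mk.injEq, Finset.ext_iff]
    at hs ⊢
  have ha := hs a
  have hb := hs b
  have hc := hs c
  grind

/-- A coherent orientation traverses a common edge of two faces in opposite directions. -/
theorem IsCoherent.mem_dedges_iff {F : Finset (Finset ℕ)} {σ : Finset ℕ → ℕ × ℕ × ℕ}
    (h : IsCoherent F σ) {f g : Finset ℕ} {a b c d : ℕ} (hf : f ∈ F) (hg : g ∈ F)
    (hfc : f = {a, b, c}) (hgd : g = {a, b, d}) (hnodup : [a, b, c, d].Nodup) :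
    (a, b) ∈ dedges (σ f) ↔ (b, a) ∈ dedges (σ g) := by
  simp only [List.nodup_cons, List.mem_cons, List.not_mem_nil, or_false, not_or,
    not_false_eq_true, List.nodup_nil, and_true] at hnodup
  obtain ⟨⟨hab, hac, had⟩, ⟨hbc, hbd⟩, hcd⟩ := hnodup
  have hfg : f ≠ g := by
    rintro rfl
    have : c ∈ ({a, b, d} : Finset ℕ) := by rw [← hgd, hfc]; simp
    simp only [Finset.mem_insert, Finset.mem_singleton] at this
    tauto
  have h1 := mem_dedges_swap ((h.1 f hf).trans hfc) hab hbc hac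
  have h2 := mem_dedges_swap ((h.1 g hg).trans hgd) hab hbd had
  have hdis := h.2 f hf g hg hfg
  constructor
  · exact fun hm => h2.2 (Finset.disjoint_left.1 hdis hm)
  · intro hm
    by_contra hn
    exact Finset.disjoint_left.1 hdis (h1.2 hn) hm

/-- The faces `{v, a, b}` for the consecutive pairs `a, b` in the list `us`. -/
def linkFaces (v : ℕ) (us : List ℕ) : List (Finset ℕ) :=
  List.zipWith (fun a b => {v, a, b}) us us.tail

/-- A certificate that the list `D :: l` consists of the faces of a triangulation with vertices
`0, …, n - 1` in which `D` can be removed as in `Gluable`: the list is a path in the dual graph,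
the `v`-th entry of `rot` lists the neighbours of `v` in cyclic order, with `D` coming last, and
every edge with `p` lies in one of the nonfacial triangles in `N`. -/
structure IsCertificate (n : ℕ) (D : Finset ℕ) (l : List (Finset ℕ)) (rot : List (List ℕ))
    (N : List (Finset ℕ)) (p : Finset ℕ → Prop) : Prop where
  nodup : (D :: l).Nodup
  card_eq_three : ∀ f ∈ D :: l, f.card = 3
  lt : ∀ f ∈ D :: l, ∀ v ∈ f, v < n
  exists_mem : ∀ v < n, ∃ f ∈ D :: l, v ∈ f
  edge_in_two_faces : ∀ f ∈ D :: l, ∀ e ∈ Finset.powersetCard 2 f,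
    ((D :: l).filter (fun f => e ⊆ f)).length = 2
  isChain : (D :: l).IsChain (fun f g => (f ∩ g).card = 2)
  isChain_link : ∀ v < n, (linkFaces v (rot.getD v [])).IsChain (fun f g => (f ∩ g).card = 2)
  mem_link : ∀ v < n, ∀ f ∈ D :: l, v ∈ f → f ∈ linkFaces v (rot.getD v [])
  of_mem_link : ∀ v < n, ∀ f ∈ linkFaces v (rot.getD v []), f ∈ D :: l ∧ v ∈ f
  mem_link_dropLast : ∀ v ∈ D, ∀ f ∈ l, v ∈ f → f ∈ (linkFaces v (rot.getD v [])).dropLast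
  of_mem_link_dropLast : ∀ v ∈ D, ∀ f ∈ (linkFaces v (rot.getD v [])).dropLast, f ∈ l
  nonfacial : ∀ t ∈ N, t.card = 3 ∧ t ∉ D :: l ∧
    ∀ e ∈ Finset.powersetCard 2 t, ∃ f ∈ D :: l, e ⊆ f
  cover : ∀ f ∈ D :: l, ∀ e ∈ Finset.powersetCard 2 f, p e → ∃ t ∈ N, e ⊆ t

namespace IsCertificate

variable {n : ℕ} {D : Finset ℕ} {l : List (Finset ℕ)} {rot : List (List ℕ)}
  {N : List (Finset ℕ)} {p : Finset ℕ → Prop}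

/-- The triangulation described by a certificate. -/
def triangulation (h : IsCertificate n D l rot N p) : Triangulation where
  faces := (D :: l).toFinset
  faces_nonempty := ⟨D, by simp⟩
  card_eq_three f hf := h.card_eq_three f (List.mem_toFinset.1 hf)
  edge_in_two_faces e he hex := by
    obtain ⟨f, hf, hef⟩ := hex
    have : (D :: l).toFinset.filter (fun f => e ⊆ f) =
        ((D :: l).filter (fun f => e ⊆ f)).toFinset := by
      ext
      simp
    rw [this, List.toFinset_card_of_nodup (h.nodup.filter _)]
    exact h.edge_in_two_faces f (List.mem_toFinset.1 hf) e (Finset.mem_powersetCard.2 ⟨hef, he⟩)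
  link_connected v f hf g hg hvf hvg := by
    have hv := h.lt f (List.mem_toFinset.1 hf) v hvf
    refine faceConnected_star_iff.1 (faceConnected_of_isChain _ (h.isChain_link v hv) ?_)
      f hf g hg hvf hvg
    intro f
    rw [Finset.mem_filter, List.mem_toFinset]
    exact ⟨h.of_mem_link v hv f, fun hf => h.mem_link v hv f hf.1 hf.2⟩
  face_connected := faceConnected_of_isChain _ h.isChain fun _ => List.mem_toFinset.symm

theorem mem_faces (h : IsCertificate n D l rot N p) {f : Finset ℕ} : f ∈ h.triangulation.faces ↔ f ∈ D :: l :=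
  List.mem_toFinset

theorem mem_erase (h : IsCertificate n D l rot N p) {f : Finset ℕ} : f ∈ h.triangulation.faces.erase D ↔ f ∈ l := by
  have := (List.nodup_cons.1 h.nodup).1
  rw [Finset.mem_erase, h.mem_faces, List.mem_cons]
  exact ⟨fun hf => hf.2.resolve_left hf.1, fun hf => ⟨fun hfD => this (hfD ▸ hf), .inr hf⟩⟩

theorem card_faces (h : IsCertificate n D l rot N p) : h.triangulation.faces.card = l.length + 1 :=
  List.toFinset_card_of_nodup h.nodup

theorem verts_eq (h : IsCertificate n D l rot N p) : h.triangulation.verts = Finset.range n := by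
  ext v
  rw [verts, mem_vertsOf, Finset.mem_range]
  constructor
  · rintro ⟨f, hf, hvf⟩
    exact h.lt f (h.mem_faces.1 hf) v hvf
  · intro hv
    obtain ⟨f, hf, hvf⟩ := h.exists_mem v hv
    exact ⟨f, h.mem_faces.2 hf, hvf⟩

theorem inNonfacialTriangle (h : IsCertificate n D l rot N p) {f e : Finset ℕ} (hf : f ∈ h.triangulation.faces) (hef : e ⊆ f)
    (he : e.card = 2) (hp : p e) : InNonfacialTriangle h.triangulation.faces e := by
  obtain ⟨t, ht, het⟩ :=
    h.cover f (h.mem_faces.1 hf) e (Finset.mem_powersetCard.2 ⟨hef, he⟩) hp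
  obtain ⟨h3, htF, hd⟩ := h.nonfacial t ht
  refine ⟨t, h3, het, fun hm => htF (h.mem_faces.1 hm), fun d hdt hd2 => ?_⟩
  obtain ⟨f, hf, hdf⟩ := hd d (Finset.mem_powersetCard.2 ⟨hdt, hd2⟩)
  exact ⟨f, h.mem_faces.2 hf, hdf⟩

theorem isPiece (h : IsCertificate n D l rot N p) {s k g : ℕ} {E : Set (Finset ℕ)} (hs : s ≤ 3) (hn : n = k + 3)
    (hD : ({0, 1, 2} : Finset ℕ).map (gap s k) = D) (hl : l.length + 5 = 2 * (k + 3) + 2 * g)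
    (hp : ∀ e, e ⊆ D ∨ e ∈ E ∨ p e) : IsPiece s k g E h.triangulation where
  le_three := hs
  verts_eq := by rw [h.verts_eq, hn]
  card_faces := by rw [h.card_faces, ← hl]
  mem_faces := by rw [hD, h.mem_faces]; exact List.mem_cons_self
  faceConnected := by
    rw [hD]
    exact faceConnected_of_isChain l h.isChain.of_cons fun _ => h.mem_erase.symm
  faceConnected_star v hv := by
    rw [hD] at hv ⊢
    have hvn := h.lt D List.mem_cons_self v hv
    refine faceConnected_of_isChain _ (h.isChain_link v hvn).dropLast fun f => ?_
    rw [Finset.mem_filter, h.mem_erase]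
    exact ⟨fun hf => ⟨h.of_mem_link_dropLast v hv f hf,
      (h.of_mem_link v hvn f (List.mem_of_mem_dropLast hf)).2⟩,
      fun hf => h.mem_link_dropLast v hv f hf.1 hf.2⟩
  inNonfacialTriangle f hf e hef he := by
    rw [hD]
    exact (hp e).imp_right (Or.imp_right (h.inNonfacialTriangle hf hef he))

end IsCertificate

/-- The irreducible triangulation of the projective plane with seven vertices. -/
theorem isCertificate_projectivePlane : IsCertificate 7 {4, 5, 6}
    [{0, 5, 6}, {0, 2, 5}, {0, 1, 2}, {0, 1, 6}, {1, 3, 6}, {1, 3, 5}, {1, 4, 5}, {1, 2, 4},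
      {2, 4, 6}, {2, 3, 6}, {2, 3, 5}]
    [[1, 6, 5, 2, 1], [0, 6, 3, 5, 4, 2, 0], [0, 5, 3, 6, 4, 1, 0], [1, 6, 2, 5, 1],
      [5, 1, 2, 6, 5], [4, 1, 3, 2, 0, 6, 4], [4, 2, 3, 1, 0, 5, 4]]
    [{1, 2, 5}, {0, 2, 6}, {1, 4, 6}, {3, 5, 6}, {0, 1, 5}, {2, 4, 5}, {1, 2, 3}]
    (fun _ => True) := by
  constructor <;> decide +kernel

/-- The tetrahedron with vertices `0, 1, 2, 7` and a crosscap in the face `{0, 2, 7}`. -/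
theorem isCertificate_tetrahedron : IsCertificate 8 {0, 1, 7}
    [{0, 5, 7}, {0, 5, 6}, {0, 2, 6}, {0, 1, 2}, {1, 2, 7}, {2, 4, 7}, {4, 6, 7}, {4, 5, 6},
      {2, 4, 5}, {2, 3, 5}, {3, 5, 7}, {3, 6, 7}, {2, 3, 6}]
    [[1, 2, 6, 5, 7, 1], [0, 2, 7, 0], [0, 6, 3, 5, 4, 7, 1, 0], [2, 6, 7, 5, 2],
      [2, 7, 6, 5, 2], [0, 7, 3, 2, 4, 6, 0], [0, 5, 4, 7, 3, 2, 0], [0, 5, 3, 6, 4, 2, 1, 0]]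
    [{2, 5, 7}, {2, 4, 6}, {3, 5, 6}, {0, 6, 7}, {4, 5, 7}, {2, 3, 7}, {0, 2, 5}]
    (fun e => ¬ e ⊆ {0, 1, 7} ∧ ¬ e ⊆ {0, 1, 2}) := by
  constructor <;> decide +kernel

/-- The octahedron with opposite vertices `0, 11` and `1, 12` and `2, 13`, and with crosscaps in
the faces `{1, 11, 13}` and `{2, 11, 12}`. -/
theorem isCertificate_octahedron : IsCertificate 14 {0, 12, 13}
    [{11, 12, 13}, {5, 11, 13}, {5, 6, 11}, {1, 6, 11}, {1, 3, 6}, {1, 3, 5}, {3, 5, 13},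
      {3, 6, 13}, {4, 6, 13}, {4, 5, 6}, {1, 4, 5}, {1, 4, 13}, {0, 1, 13}, {0, 1, 2},
      {0, 2, 12}, {2, 8, 12}, {2, 8, 10}, {8, 9, 10}, {8, 9, 12}, {7, 9, 12}, {2, 7, 9},
      {2, 7, 10}, {7, 10, 12}, {10, 11, 12}, {9, 10, 11}, {2, 9, 11}, {1, 2, 11}]
    [[12, 2, 1, 13, 12], [0, 13, 4, 5, 3, 6, 11, 2, 0], [0, 12, 8, 10, 7, 9, 11, 1, 0],
      [1, 6, 13, 5, 1], [1, 13, 6, 5, 1], [1, 4, 6, 11, 13, 3, 1], [1, 11, 5, 4, 13, 3, 1],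
      [2, 10, 12, 9, 2], [2, 12, 9, 10, 2], [2, 11, 10, 8, 12, 7, 2], [2, 8, 9, 11, 12, 7, 2],
      [1, 6, 5, 13, 12, 10, 9, 2, 1], [0, 2, 8, 9, 7, 10, 11, 13, 0],
      [0, 1, 4, 6, 3, 5, 11, 12, 0]]
    [{1, 5, 13}, {6, 11, 13}, {1, 4, 6}, {3, 5, 6}, {2, 9, 12}, {2, 10, 11}, {8, 10, 12},
      {7, 9, 10}, {1, 5, 11}, {4, 5, 13}, {1, 3, 13}, {9, 11, 12}, {2, 8, 9}, {2, 7, 12}]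
    (fun e => ¬ e ⊆ {0, 12, 13} ∧ ¬ e ⊆ {0, 1, 2}) := by
  constructor <;> decide +kernel

/-- A set of faces containing a certain Möbius band has no coherent orientation. -/
theorem not_isCoherent_of_moebius {F : Finset (Finset ℕ)}
    (hF : ∀ f ∈ ([{0, 2, 5}, {5, 0, 6}, {6, 5, 4}, {4, 6, 2}, {2, 6, 3}, {3, 2, 5}] :
      List (Finset ℕ)), f ∈ F) : ¬ ∃ σ, IsCoherent F σ := by
  rintro ⟨σ, hσ⟩
  simp only [List.forall_mem_cons, List.not_mem_nil, false_imp_iff, implies_true, and_true] at hF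
  obtain ⟨h1, h2, h3, h4, h5, h6⟩ := hF
  have rot : ∀ f ∈ F, ∀ a b c : ℕ, f = {a, b, c} → a ≠ b → b ≠ c → a ≠ c →
      ((a, b) ∈ dedges (σ f) ↔ (b, c) ∈ dedges (σ f)) := fun f hf a b c hfc =>
    mem_dedges_rotate ((hσ.1 f hf).trans hfc)
  have key : (2, 5) ∈ dedges (σ {0, 2, 5}) ↔ (5, 2) ∈ dedges (σ {0, 2, 5}) :=
    (rot _ h1 2 5 0 (by decide) (by decide) (by decide) (by decide)).trans <|
    (hσ.mem_dedges_iff (a := 5) (b := 0) (c := 2) (d := 6) h1 h2 (by decide) (by decide) (by decide)).trans <|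
    (rot _ h2 0 5 6 (by decide) (by decide) (by decide) (by decide)).trans <|
    (hσ.mem_dedges_iff (a := 5) (b := 6) (c := 0) (d := 4) h2 h3 (by decide) (by decide) (by decide)).trans <|
    (rot _ h3 6 5 4 (by decide) (by decide) (by decide) (by decide)).trans <|
    (rot _ h3 5 4 6 (by decide) (by decide) (by decide) (by decide)).trans <|
    (hσ.mem_dedges_iff (a := 4) (b := 6) (c := 5) (d := 2) h3 h4 (by decide) (by decide) (by decide)).trans <|
    (rot _ h4 6 4 2 (by decide) (by decide) (by decide) (by decide)).trans <|
    (rot _ h4 4 2 6 (by decide) (by decide) (by decide) (by decide)).trans <|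
    (hσ.mem_dedges_iff (a := 2) (b := 6) (c := 4) (d := 3) h4 h5 (by decide) (by decide) (by decide)).trans <|
    (rot _ h5 6 2 3 (by decide) (by decide) (by decide) (by decide)).trans <|
    (hσ.mem_dedges_iff (a := 2) (b := 3) (c := 6) (d := 5) h5 h6 (by decide) (by decide) (by decide)).trans <|
    (rot _ h6 3 2 5 (by decide) (by decide) (by decide) (by decide)).trans <|
    hσ.mem_dedges_iff (a := 2) (b := 5) (c := 3) (d := 0) h6 h1 (by decide) (by decide) (by decide)
  have hs : ({0, 2, 5} : Finset ℕ) = {2, 5, 0} := by decide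
  have := mem_dedges_swap ((hσ.1 _ h1).trans hs) (by decide) (by decide) (by decide)
  tauto

theorem isMarked_projectivePlane :
    IsMarked 1 7 isCertificate_projectivePlane.triangulation where
  mem_faces := by rw [IsCertificate.mem_faces]; decide
  card_verts := by rw [IsCertificate.verts_eq, Finset.card_range]
  card_faces := by rw [IsCertificate.card_faces]; rfl
  not_coherent := by
    refine not_isCoherent_of_moebius fun f hf => ?_
    rw [Finset.mem_erase, IsCertificate.mem_faces]
    revert f
    decide +kernel
  inNonfacialTriangle f hf e hef he :=
    .inr (isCertificate_projectivePlane.inNonfacialTriangle hf hef he trivial)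

theorem isPiece_projectivePlane :
    IsPiece 0 4 1 ∅ isCertificate_projectivePlane.triangulation :=
  isCertificate_projectivePlane.isPiece (by omega) rfl (by decide) rfl fun _ => .inr (.inr trivial)

theorem isPiece_tetrahedron :
    IsPiece 2 5 1 {e | e ⊆ {0, 1, 2}} isCertificate_tetrahedron.triangulation :=
  isCertificate_tetrahedron.isPiece (by omega) rfl (by decide) rfl fun e => by
    rw [Set.mem_ofPred_eq]; tauto

theorem isPiece_octahedron :
    IsPiece 1 11 2 {e | e ⊆ {0, 1, 2}} isCertificate_octahedron.triangulation :=
  isCertificate_octahedron.isPiece (by omega) rfl (by decide) rfl fun e => by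
    rw [Set.mem_ofPred_eq]; tauto

theorem exists_isMarked_add {g n : ℕ} (h : ∃ T, IsMarked g n T) (m : ℕ) :
    ∃ T, IsMarked (g + 2 * m) (n + 11 * m) T := by
  induction m with
  | zero => exact h
  | succ m ih =>
    obtain ⟨T, hT⟩ := ih
    exact hT.extend isPiece_octahedron (by rw [IsCertificate.mem_faces]; decide +kernel) (by decide)

theorem exists_isMarked_two : ∃ T, IsMarked 2 12 T :=
  isMarked_projectivePlane.extend isPiece_tetrahedron
    (by rw [IsCertificate.mem_faces]; decide +kernel) (by decide)

theorem exists_irreducible_of_isMarked {g n : ℕ} (h : ∃ T, IsMarked g n T) (m : ℕ) :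
    ∃ T : Triangulation, T.IsN (g + 2 * m + 1) ∧ T.Irreducible ∧
      T.verts.card = n + 11 * m + 4 := by
  obtain ⟨T, hT⟩ := exists_isMarked_add h m
  exact hT.close isPiece_projectivePlane

theorem exists_irreducible_isN_one :
    ∃ T : Triangulation, T.IsN 1 ∧ T.Irreducible ∧ T.verts.card = 7 := by
  have hT := isMarked_projectivePlane
  refine ⟨_, ⟨euler_eq_of_card hT.card_verts hT.card_faces, ?_⟩, ?_, hT.card_verts⟩
  · rintro ⟨σ, hσ⟩
    exact hT.not_coherent ⟨σ, hσ.mono (Finset.erase_subset _ _)⟩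
  · exact irreducible_of_inNonfacialTriangle fun f hf e hef he =>
      isCertificate_projectivePlane.inNonfacialTriangle hf hef he trivial

end Triangulation

/-- For every `g ≥ 1` there is an irreducible triangulation of the nonorientable surface
`N_g` with at least `⌊11 g / 2⌋` vertices; hence `V_max(N_g) ≥ ⌊11 g / 2⌋`. -/
theorem vmax_nonorientable_lower_bound :
    ∀ g : ℕ, 1 ≤ g →
      ∃ T : Triangulation, T.IsN g ∧ T.Irreducible ∧ 11 * g / 2 ≤ T.verts.card := by
  intro g hg
  obtain rfl | ⟨m, rfl⟩ | ⟨m, rfl⟩ :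
      g = 1 ∨ (∃ m, g = 1 + 2 * m + 1) ∨ ∃ m, g = 2 + 2 * m + 1 := by
    rcases Nat.even_or_odd' g with ⟨m, rfl | rfl⟩
    · exact .inr (.inl ⟨m - 1, by omega⟩)
    · rcases m with _ | m
      · exact .inl rfl
      · exact .inr (.inr ⟨m, by omega⟩)
  · obtain ⟨T, hN, hI, hv⟩ := Triangulation.exists_irreducible_isN_one
    exact ⟨T, hN, hI, by omega⟩
  · obtain ⟨T, hN, hI, hv⟩ := Triangulation.exists_irreducible_of_isMarked
      ⟨_, Triangulation.isMarked_projectivePlane⟩ m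
    exact ⟨T, hN, hI, by omega⟩
  · obtain ⟨T, hN, hI, hv⟩ := Triangulation.exists_irreducible_of_isMarked
      Triangulation.exists_isMarked_two m
    exact ⟨T, hN, hI, by omega⟩
end
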